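/- arXiv:0807.1963 — 4 statements merged into one kernel-verified Lean document; each statement's English description precedes it below -/
import Mathlib

section
/- Let k: ℝ^r → [0,∞) and ξ satisfy hypotheses (HG), with associated domain 𝐝 and form e. If u ∈ 𝐝 and F: ℝ → ℝ is a normal contraction (|F(a) − F(b)| ≤ |a − b| for all a,b and F(0) = 0), then F∘u ∈ 𝐝 and e[F∘u] ≤ e[u]; in particular the form e is Markovian (a Dirichlet form). -/
open MeasureTheory Set Filter

noncomputable section

/-- `Rset ρ` : the largest open subset of `ℝ` on which `ρ⁻¹` is locally integrable. -/
def Rset (ρ : ℝ → ℝ) : Set ℝ :=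
  {t : ℝ | ∃ ε > (0 : ℝ), IntegrableOn (fun s => (ρ s)⁻¹) (Ioo (t - ε) (t + ε)) volume}

/-- Hypotheses (HG) for the pair `(k, ξ)` on `ℝ^r`:
`k` is a nonnegative Borel function whose one-dimensional sections satisfy the
generalized Hamza condition, and `ξ` is a symmetric Borel matrix-valued function
which is locally elliptic on an open set of full Lebesgue measure. -/
structure HG (r : ℕ) (k : (Fin r → ℝ) → ℝ) (ξ : Fin r → Fin r → (Fin r → ℝ) → ℝ) : Prop where
  k_meas : Measurable k
  k_nonneg : ∀ x, 0 ≤ k x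
  hamza : ∀ i : Fin r, ∀ᵐ x ∂(volume : Measure (Fin r → ℝ)),
    (0 < ∫ s : ℝ, k (Function.update x i s)) →
      ∀ᵐ s ∂(volume : Measure ℝ),
        s ∉ Rset (fun t => k (Function.update x i t)) → k (Function.update x i s) = 0
  xi_meas : ∀ i j, Measurable (ξ i j)
  xi_symm : ∀ i j x, ξ i j x = ξ j i x
  elliptic : ∃ O : Set (Fin r → ℝ), IsOpen O ∧ volume Oᶜ = 0 ∧
    ∀ K : Set (Fin r → ℝ), K ⊆ O → IsCompact K → ∃ c > (0 : ℝ), ∀ x ∈ K, ∀ v : Fin r → ℝ,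
      c * (∑ i, v i ^ 2) ≤ ∑ i, ∑ j, ξ i j x * v i * v j

/-- Membership of `u` in the domain `𝐝` of the form associated to `(k, ξ)`,
with partial-derivative data `du` : `u` is a Borel function of `L²(k dx)`,
λ^{r-1}-almost every one-dimensional section of `u` along the `i`-th coordinate
admits an absolutely continuous version on `R(k^{(i)}_{x̄})` whose derivative is
the corresponding section of `du i`, and `Σ_{i,j} ξ_{ij} ∂_i u ∂_j u ∈ L¹(k dx)`. -/
structure MemDom (r : ℕ) (k : (Fin r → ℝ) → ℝ) (ξ : Fin r → Fin r → (Fin r → ℝ) → ℝ)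
    (u : (Fin r → ℝ) → ℝ) (du : Fin r → (Fin r → ℝ) → ℝ) : Prop where
  meas : Measurable u
  du_meas : ∀ i, Measurable (du i)
  memL2 : Integrable (fun x => u x ^ 2 * k x) volume
  sectionsAC : ∀ i : Fin r, ∀ᵐ x ∂(volume : Measure (Fin r → ℝ)),
    ∃ v : ℝ → ℝ,
      (∀ᵐ s ∂(volume : Measure ℝ), s ∈ Rset (fun t => k (Function.update x i t)) →
        v s = u (Function.update x i s)) ∧
      ∀ a b : ℝ, a ≤ b → Icc a b ⊆ Rset (fun t => k (Function.update x i t)) →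
        IntegrableOn (fun s => du i (Function.update x i s)) (Icc a b) volume ∧
        v b - v a = ∫ s in a..b, du i (Function.update x i s)
  energyInt : Integrable (fun x => (∑ i, ∑ j, ξ i j x * du i x * du j x) * k x) volume

/-- The Dirichlet form `e[u] = ½ ∫ Σ_{i,j} ξ_{ij} ∂_i u ∂_j u k dx`, expressed through
the partial-derivative data `du` of `u`. -/
def energy (r : ℕ) (k : (Fin r → ℝ) → ℝ) (ξ : Fin r → Fin r → (Fin r → ℝ) → ℝ)
    (du : Fin r → (Fin r → ℝ) → ℝ) : ℝ :=
  (1 / 2) * ∫ x, (∑ i, ∑ j, ξ i j x * du i x * du j x) * k x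

/-- If `N` is a Lebesgue null set, then the derivative of `f` vanishes at almost every point of
`f ⁻¹' N` at which it exists. -/
theorem ae_hasDerivAt_eq_zero_of_mem_null (f : ℝ → ℝ) {N : Set ℝ} (hN : volume N = 0) :
    ∀ᵐ x, ∀ f', HasDerivAt f f' x → f x ∈ N → f' = 0 := by
  let B : ℕ → ℚ → Set ℝ := fun n q => {x | |x - q| < 1 / (2 * (n + 1)) ∧ f x ∈ N ∧
    ∀ y, |y - x| < 1 / (n + 1) → |y - x| ≤ (n + 1) * |f y - f x|}
  have hB : ∀ n q, volume (B n q) = 0 := by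
    intro n q
    have hanti : AntilipschitzWith (n + 1 : NNReal) (fun x : B n q => f x) := by
      refine AntilipschitzWith.of_le_mul_dist fun x y => ?_
      have hxy : |(x : ℝ) - y| < 1 / (n + 1) := by
        have hx := abs_lt.1 x.2.1
        have hy := abs_lt.1 y.2.1
        have h2 : (1 : ℝ) / (n + 1) = 1 / (2 * (n + 1)) + 1 / (2 * (n + 1)) := by
          field_simp; norm_num
        rw [h2, abs_lt]
        constructor <;> linarith [hx.1, hx.2, hy.1, hy.2]
      simpa [Subtype.dist_eq, Real.dist_eq] using y.2.2.2 x hxy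
    have himage : (fun x : B n q => f x) '' univ ⊆ N := by
      rintro _ ⟨x, -, rfl⟩
      exact x.2.2.1
    have h := hanti.le_hausdorffMeasure_image zero_le_one univ
    rw [hausdorffMeasure_real, measure_mono_null himage hN, mul_zero,
      ← isometry_subtype_coe.hausdorffMeasure_image (Or.inl zero_le_one), image_univ,
      Subtype.range_coe, hausdorffMeasure_real] at h
    exact nonpos_iff_eq_zero.1 h
  have hU : volume (⋃ n, ⋃ q, B n q) = 0 := measure_iUnion_null fun n => measure_iUnion_null (hB n)
  filter_upwards [measure_eq_zero_iff_ae_notMem.1 hU] with x hx f' hf' hfx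
  by_contra hne
  have hev : ∀ᶠ y in nhds x, |f'| / 2 * |y - x| ≤ |f y - f x| := by
    filter_upwards [(hasDerivAt_iff_isLittleO.1 hf').bound (half_pos (abs_pos.2 hne))] with y hy
    rw [Real.norm_eq_abs, Real.norm_eq_abs, smul_eq_mul] at hy
    have h1 := abs_sub_abs_le_abs_sub ((y - x) * f') (f y - f x)
    rw [abs_sub_comm ((y - x) * f'), abs_mul] at h1
    linarith
  obtain ⟨δ, hδ, hball⟩ := Metric.eventually_nhds_iff.1 hev
  obtain ⟨n, hn⟩ := exists_nat_gt (max (1 / δ) (2 / |f'|))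
  have hn0 : (0 : ℝ) < n + 1 := by positivity
  have hnδ : 1 / ((n : ℝ) + 1) < δ := by
    rw [div_lt_comm₀ hn0 hδ]
    linarith [(max_lt_iff.1 hn).1]
  have hnf : 1 ≤ ((n : ℝ) + 1) * (|f'| / 2) := by
    have h2 := (div_lt_iff₀ (abs_pos.2 hne)).1 (max_lt_iff.1 hn).2
    nlinarith [abs_pos.2 hne]
  obtain ⟨q, hq1, hq2⟩ := exists_rat_btwn
    (show x < x + 1 / (2 * ((n : ℝ) + 1)) from lt_add_of_pos_right x (by positivity))
  refine hx (mem_iUnion.2 ⟨n, mem_iUnion.2 ⟨q, ?_, hfx, fun y hy => ?_⟩⟩)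
  · rw [abs_lt]
    constructor <;> linarith
  · have h3 := hball (y := y) (by rw [Real.dist_eq]; exact hy.trans hnδ)
    calc |y - x| ≤ ((n : ℝ) + 1) * (|f'| / 2) * |y - x| :=
          le_mul_of_one_le_left (abs_nonneg _) hnf
      _ = ((n : ℝ) + 1) * (|f'| / 2 * |y - x|) := by ring
      _ ≤ _ := mul_le_mul_of_nonneg_left h3 hn0.le

/-- The chain rule for a Lipschitz outer function, which may fail to be differentiable where the
inner function is stationary. -/
theorem LipschitzWith.hasDerivAt_comp {K : NNReal} {F w : ℝ → ℝ} (hF : LipschitzWith K F)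
    {c s : ℝ} (hw : HasDerivAt w c s) (h : ¬ DifferentiableAt ℝ F (w s) → c = 0) :
    HasDerivAt (fun t => F (w t)) (deriv F (w s) * c) s := by
  by_cases hd : DifferentiableAt ℝ F (w s)
  · exact hd.hasDerivAt.comp s hw
  · obtain rfl := h hd
    rw [hasDerivAt_iff_isLittleO] at hw ⊢
    simp only [smul_zero, sub_zero, mul_zero] at hw ⊢
    refine Asymptotics.IsBigO.trans_isLittleO ?_ hw
    refine Asymptotics.IsBigO.of_bound K (Eventually.of_forall fun t => ?_)
    simpa [Real.dist_eq] using hF.dist_le_mul (w t) (w s)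

theorem LipschitzWith.comp_absolutelyContinuousOnInterval {K : NNReal} {F w : ℝ → ℝ}
    (hF : LipschitzWith K F) {a b : ℝ} (hw : AbsolutelyContinuousOnInterval w a b) :
    AbsolutelyContinuousOnInterval (fun t => F (w t)) a b := by
  refine squeeze_zero (fun t => Finset.sum_nonneg fun i _ => dist_nonneg) (fun t => ?_)
    (by simpa using Tendsto.const_mul (K : ℝ) hw)
  rw [Finset.mul_sum]
  exact Finset.sum_le_sum fun i _ => hF.dist_le_mul _ _

/-- The fundamental theorem of calculus for the composition of a Lipschitz function with an
indefinite integral. -/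
theorem LipschitzWith.integral_deriv_comp_mul {K : NNReal} {F g : ℝ → ℝ} (hF : LipschitzWith K F)
    {a b : ℝ} (hg : IntervalIntegrable g volume a b) (c : ℝ) :
    F (c + ∫ t in a..b, g t) - F c =
      ∫ s in a..b, deriv F (c + ∫ t in a..s, g t) * g s := by
  set w : ℝ → ℝ := fun s => c + ∫ t in a..s, g t with hw
  have hwac : AbsolutelyContinuousOnInterval w a b := by
    refine AbsolutelyContinuousOnInterval.fun_add ?_
      (hg.absolutelyContinuousOnInterval_intervalIntegral left_mem_uIcc)
    exact (LipschitzWith.const c).lipschitzOnWith.absolutelyContinuousOnInterval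
  have hN : volume {y | ¬ DifferentiableAt ℝ F y} = 0 := hF.ae_differentiableAt_real
  have hFTC := (hF.comp_absolutelyContinuousOnInterval hwac).integral_deriv_eq_sub
  have hwa : w a = c := by simp [hw]
  rw [hwa] at hFTC
  rw [← hFTC]
  refine intervalIntegral.integral_congr_ae ?_
  filter_upwards [hg.ae_hasDerivAt_integral, ae_hasDerivAt_eq_zero_of_mem_null w hN]
    with s hs hs0 hsab
  have hd : HasDerivAt w (g s) s :=
    (hs (uIoc_subset_uIcc hsab) a left_mem_uIcc).const_add c
  exact (hF.hasDerivAt_comp hd fun h => hs0 _ hd h).deriv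

theorem HG.ae_quadratic_nonneg {r : ℕ} {k : (Fin r → ℝ) → ℝ} {ξ : Fin r → Fin r → (Fin r → ℝ) → ℝ}
    (h : HG r k ξ) :
    ∀ᵐ x, ∀ v : Fin r → ℝ, 0 ≤ ∑ i, ∑ j, ξ i j x * v i * v j := by
  obtain ⟨O, -, hO, hell⟩ := h.elliptic
  filter_upwards [measure_eq_zero_iff_ae_notMem.1 hO] with x hx v
  obtain ⟨c, hc, hcx⟩ := hell {x} (singleton_subset_iff.2 (not_not.1 hx)) isCompact_singleton
  exact (by positivity : 0 ≤ c * ∑ i, v i ^ 2).trans (hcx x rfl v)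

/-- Under hypotheses (HG), normal contractions operate on the form:
if `u ∈ 𝐝` and `F : ℝ → ℝ` is a normal contraction (`|F a − F b| ≤ |a − b|`, `F 0 = 0`),
then `F ∘ u ∈ 𝐝` and `e[F ∘ u] ≤ e[u]`; in particular `e` is a Dirichlet form. -/
theorem normal_contraction_operates (r : ℕ) (k : (Fin r → ℝ) → ℝ)
    (ξ : Fin r → Fin r → (Fin r → ℝ) → ℝ) (hHG : HG r k ξ)
    (u : (Fin r → ℝ) → ℝ) (du : Fin r → (Fin r → ℝ) → ℝ)
    (hmem : MemDom r k ξ u du)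
    (F : ℝ → ℝ) (hF0 : F 0 = 0) (hFlip : ∀ a b : ℝ, |F a - F b| ≤ |a - b|) :
    ∃ dv : Fin r → (Fin r → ℝ) → ℝ,
      MemDom r k ξ (fun x => F (u x)) dv ∧
      energy r k ξ dv ≤ energy r k ξ du := by
  have hLip : LipschitzWith 1 F := LipschitzWith.of_dist_le_mul fun a b => by
    simpa [Real.dist_eq] using hFlip a b
  have hderiv : ∀ y, |deriv F y| ≤ 1 := fun y => by
    simpa using norm_deriv_le_of_lipschitz (x₀ := y) hLip
  have hdmeas : Measurable fun x => deriv F (u x) := (measurable_deriv F).comp hmem.meas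
  have hquad : ∀ x, (∑ i, ∑ j, ξ i j x * (deriv F (u x) * du i x) * (deriv F (u x) * du j x)) * k x
      = deriv F (u x) ^ 2 * ((∑ i, ∑ j, ξ i j x * du i x * du j x) * k x) := fun x => by
    simp only [Finset.mul_sum, Finset.sum_mul]
    exact Finset.sum_congr rfl fun i _ => Finset.sum_congr rfl fun j _ => by ring
  have hsq : ∀ x, deriv F (u x) ^ 2 ≤ 1 := fun x => (sq_le_one_iff_abs_le_one _).2 (hderiv _)
  have hint : Integrable (fun x => (∑ i, ∑ j, ξ i j x * (deriv F (u x) * du i x) *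
      (deriv F (u x) * du j x)) * k x) volume := by
    simp only [hquad]
    refine hmem.energyInt.bdd_mul (c := 1) (hdmeas.pow_const 2).aestronglyMeasurable
      (Eventually.of_forall fun x => ?_)
    rw [Real.norm_of_nonneg (sq_nonneg _)]
    exact hsq x
  refine ⟨fun i x => deriv F (u x) * du i x, ⟨hLip.continuous.measurable.comp hmem.meas,
    fun i => hdmeas.mul (hmem.du_meas i), ?_, fun i => ?_, hint⟩, ?_⟩
  · refine hmem.memL2.mono' (((hLip.continuous.measurable.comp hmem.meas).pow_const 2).mul
      hHG.k_meas).aestronglyMeasurable (Eventually.of_forall fun x => ?_)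
    rw [Real.norm_of_nonneg (mul_nonneg (sq_nonneg _) (hHG.k_nonneg x))]
    refine mul_le_mul_of_nonneg_right (sq_le_sq.2 ?_) (hHG.k_nonneg x)
    simpa [hF0] using hFlip (u x) 0
  · filter_upwards [hmem.sectionsAC i] with x hx
    obtain ⟨v, hvu, hv⟩ := hx
    refine ⟨fun s => F (v s), ?_, fun a b hab hR => ?_⟩
    · filter_upwards [hvu] with s hs hsR
      rw [hs hsR]
    · obtain ⟨hgi, hvab⟩ := hv a b hab hR
      refine ⟨?_, ?_⟩
      · refine Integrable.bdd_mul (c := 1) hgi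
          (hdmeas.comp (measurable_update x)).aestronglyMeasurable
          (Eventually.of_forall fun s => hderiv _)
      · have hgii : IntervalIntegrable (fun s => du i (Function.update x i s)) volume a b :=
          (intervalIntegrable_iff_integrableOn_Icc_of_le hab).2 hgi
        have hFTC := hLip.integral_deriv_comp_mul hgii (v a)
        rw [← hvab, add_sub_cancel] at hFTC
        rw [hFTC]
        refine intervalIntegral.integral_congr_ae ?_
        filter_upwards [hvu] with s hs hsab
        rw [uIoc_of_le hab] at hsab
        have hs' := (hv a s hsab.1.le ((Icc_subset_Icc_right hsab.2).trans hR)).2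
        rw [← hs', add_sub_cancel, hs (hR (Ioc_subset_Icc_self hsab))]
  · refine mul_le_mul_of_nonneg_left (integral_mono_ae hint hmem.energyInt ?_) (by norm_num)
    filter_upwards [hHG.ae_quadratic_nonneg] with x hx
    simp only [hquad]
    exact mul_le_of_le_one_left (mul_nonneg (hx _) (hHG.k_nonneg x)) (hsq x)
end
end

section
/- (Energy image density for a finite product.) For i = 1,…,n let k_i: ℝ^r → [0,∞) be Borel with ∫ k_i dx = 1 and let ξ^i be a symmetric matrix-valued Borel function, each pair (k_i, ξ^i) satisfying hypotheses (HG), with associated domains 𝐝_i, forms e_i and carrés du champ γ_i on L²(k_i dx). On (ℝ^r)^n with product probability Λ_n = ⊗_{i=1}^n k_i dx, let 𝐝̃_n be the product domain and γ̃_n[U] = Σ_{i=1}^n γ_i[U] (γ_i acting on the i-th block of coordinates) its carré du champ. Then for every d ∈ ℕ* and every U ∈ (𝐝̃_n)^d, the image measure U_*[ det(γ̃_n[U_i,U_j])_{1≤i,j≤d} · Λ_n ] is absolutely continuous with respect to λ^d. -/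
open MeasureTheory Set Filter

noncomputable section

/-- The product measure `Λ_n = ⊗_{i=1}^n k_i dx` on `(ℝ^r)^n`. -/
def prodMeasure (n r : ℕ) (k : Fin n → (Fin r → ℝ) → ℝ) : Measure (Fin n → Fin r → ℝ) :=
  Measure.pi fun i => volume.withDensity fun y => ENNReal.ofReal (k i y)

/-- Membership of `U` in the product domain `𝐝̃_n` on `((ℝ^r)^n, Λ_n)`, with
partial-derivative data `dU i j` (derivative in the `j`-th coordinate of the `i`-th block):
`U ∈ L²(Λ_n)`, for each `i` and `Λ_n`-almost every fixed value of the other blocks the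
`i`-th partial map belongs to `𝐝_i`, and `ẽ_n(U) = Σ_i ∫ e_i[i-th partial map] dΛ_n < ∞`. -/
structure MemDomProd (n r : ℕ) (k : Fin n → (Fin r → ℝ) → ℝ)
    (ξ : Fin n → Fin r → Fin r → (Fin r → ℝ) → ℝ)
    (U : (Fin n → Fin r → ℝ) → ℝ)
    (dU : Fin n → Fin r → (Fin n → Fin r → ℝ) → ℝ) : Prop where
  meas : Measurable U
  dU_meas : ∀ i j, Measurable (dU i j)
  memL2 : Integrable (fun x => U x ^ 2) (prodMeasure n r k)
  partialMem : ∀ i : Fin n, ∀ᵐ x ∂(prodMeasure n r k),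
    MemDom r (k i) (ξ i) (fun y => U (Function.update x i y))
      (fun j => fun y => dU i j (Function.update x i y))
  energySum : Integrable
    (fun x => ∑ i, ∑ j, ∑ l, ξ i j l (x i) * dU i j x * dU i l x) (prodMeasure n r k)

section Lines

variable {E : Type*} [NormedAddCommGroup E] [NormedSpace ℝ E] [MeasurableSpace E] [BorelSpace E]

/-- A measurable property which holds almost everywhere on almost every line of direction `e`
holds almost everywhere. -/
theorem ae_of_ae_line [FiniteDimensional ℝ E] (μ : Measure E) [μ.IsAddHaarMeasure] (e : E)
    {p : E → Prop} (hp : MeasurableSet {x | p x})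
    (h : ∀ᵐ x ∂μ, ∀ᵐ s : ℝ, p (x + s • e)) : ∀ᵐ x ∂μ, p x := by
  have hm : MeasurableSet {z : E × ℝ | p (z.1 + z.2 • e)} := by
    have : Measurable fun z : E × ℝ => z.1 + z.2 • e := by fun_prop
    exact this hp
  rw [Measure.ae_ae_comm hm] at h
  obtain ⟨s, hs⟩ := h.exists
  have h2 := (measurePreserving_add_right μ (-(s • e))).quasiMeasurePreserving.ae hs
  filter_upwards [h2] with x hx
  simpa using hx

/-- `w` is essentially differentiable at `x` in the direction `e`, with derivative `c`: the
expansion of order one holds for almost every small parameter. -/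
def EssDerivAt (w : E → ℝ) (e x : E) (c : ℝ) : Prop :=
  ∀ n : ℕ, ∃ m : ℕ, ∀ᵐ s : ℝ, |s| < 1 / (m + 1) →
    |w (x + s • e) - w x - s * c| ≤ |s| / (n + 1)

theorem measurableSet_ae_real {α : Type*} [MeasurableSpace α] {p : α → ℝ → Prop}
    (hp : MeasurableSet {z : α × ℝ | p z.1 z.2}) : MeasurableSet {x | ∀ᵐ s : ℝ, p x s} := by
  have := measurable_measure_prodMk_left (ν := (volume : Measure ℝ)) hp.compl
  exact this (measurableSet_singleton 0)

theorem measurableSet_essDerivAt [FiniteDimensional ℝ E] {w g : E → ℝ} (hw : Measurable w)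
    (hg : Measurable g) (e : E) : MeasurableSet {x | EssDerivAt w e x (g x)} := by
  have : {x | EssDerivAt w e x (g x)} = ⋂ n : ℕ, ⋃ m : ℕ, {x | ∀ᵐ s : ℝ, |s| < 1 / ((m : ℝ) + 1) →
      |w (x + s • e) - w x - s * g x| ≤ |s| / (n + 1)} := by
    ext x; simp [EssDerivAt]
  rw [this]
  refine .iInter fun n => .iUnion fun m => measurableSet_ae_real ?_
  have h0 : Measurable fun z : E × ℝ => z.1 + z.2 • e := by fun_prop
  have h1 := hw.comp h0
  have h2 : Measurable fun z : E × ℝ => |w (z.1 + z.2 • e) - w z.1 - z.2 * g z.1| := by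
    simp only [Function.comp_def] at h1
    fun_prop
  have h3 : MeasurableSet {z : E × ℝ | |z.2| < 1 / ((m : ℝ) + 1)} :=
    measurableSet_lt (by fun_prop) (by fun_prop)
  exact h3.imp (measurableSet_le h2 (by fun_prop))

/-- The points `x` whose increments in the direction `e` are essentially bounded by `m |s|`
at scale `1 / (m + 1)`. -/
def lipLine (w : E → ℝ) (e : E) (m : ℕ) : Set E :=
  {x | ∀ᵐ s : ℝ, |s| < 1 / ((m : ℝ) + 1) → |w (x + s • e) - w x| ≤ m * |s|}

theorem measurableSet_lipLine [FiniteDimensional ℝ E] {w : E → ℝ} (hw : Measurable w) (e : E)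
    (m : ℕ) : MeasurableSet (lipLine w e m) := by
  refine measurableSet_ae_real ?_
  have h0 : Measurable fun z : E × ℝ => z.1 + z.2 • e := by fun_prop
  have h1 := hw.comp h0
  have h2 : Measurable fun z : E × ℝ => |w (z.1 + z.2 • e) - w z.1| := by
    simp only [Function.comp_def] at h1
    fun_prop
  have h3 : MeasurableSet {z : E × ℝ | |z.2| < 1 / ((m : ℝ) + 1)} :=
    measurableSet_lt (by fun_prop) (by fun_prop)
  exact h3.imp (measurableSet_le h2 (by fun_prop))

omit [MeasurableSpace E] [BorelSpace E] in
theorem EssDerivAt.exists_mem_lipLine {w : E → ℝ} {e x : E} {c : ℝ} (h : EssDerivAt w e x c) :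
    ∃ m, x ∈ lipLine w e m := by
  obtain ⟨m, hm⟩ := h 0
  obtain ⟨q, hq⟩ := exists_nat_ge (|c| + 1)
  refine ⟨m + q, ?_⟩
  filter_upwards [hm] with s hs hlt
  have h1 : |s| < 1 / ((m : ℝ) + 1) :=
    hlt.trans_le (one_div_le_one_div_of_le (by positivity) (by push_cast; linarith [q.cast_nonneg (α := ℝ)]))
  have h2 := hs h1
  have h3 : |w (x + s • e) - w x| ≤ |w (x + s • e) - w x - s * c| + |s * c| := by
    simpa using abs_add_le (w (x + s • e) - w x - s * c) (s * c)
  rw [abs_mul] at h3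
  simp only [Nat.cast_zero, zero_add, div_one] at h2
  have h4 : |s| * (|c| + 1) ≤ |s| * ((m + q : ℕ) : ℝ) := by
    apply mul_le_mul_of_nonneg_left _ (abs_nonneg s)
    push_cast
    linarith [m.cast_nonneg (α := ℝ)]
  linarith

/-- The points around which, at every scale `1 / (j + 1)` with `j ≥ k`, most of the line of
direction `e` lies in `S`. -/
def denseLine (S : Set E) (e : E) (k : ℕ) : Set E :=
  {x | ∀ j ≥ k, volume {s : ℝ | |s| < 1 / ((j : ℝ) + 1) ∧ x + s • e ∉ S} ≤
    ENNReal.ofReal (1 / (10 * ((j : ℝ) + 1)))}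

theorem measurableSet_denseLine [FiniteDimensional ℝ E] {S : Set E} (hS : MeasurableSet S) (e : E)
    (k : ℕ) : MeasurableSet (denseLine S e k) := by
  have : denseLine S e k = ⋂ j : ℕ, ⋂ _ : j ≥ k,
      {x | volume {s : ℝ | |s| < 1 / ((j : ℝ) + 1) ∧ x + s • e ∉ S} ≤
        ENNReal.ofReal (1 / (10 * ((j : ℝ) + 1)))} := by
    ext x; simp [denseLine]
  rw [this]
  refine .iInter fun j => .iInter fun _ => ?_
  have h0 : Measurable fun z : E × ℝ => z.1 + z.2 • e := by fun_prop
  have h2 : MeasurableSet {z : E × ℝ | |z.2| < 1 / ((j : ℝ) + 1)} :=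
    measurableSet_lt (by fun_prop) (by fun_prop)
  have h3 : MeasurableSet {z : E × ℝ | |z.2| < 1 / ((j : ℝ) + 1) ∧ z.1 + z.2 • e ∉ S} :=
    h2.inter (h0 hS.compl)
  exact measurableSet_le (measurable_measure_prodMk_left (ν := (volume : Measure ℝ)) h3)
    measurable_const

theorem ae_exists_dense_real {T : Set ℝ} (hT : MeasurableSet T) : ∀ᵐ t : ℝ, t ∈ T →
    ∃ k : ℕ, ∀ j ≥ k, volume {s : ℝ | |s| < 1 / ((j : ℝ) + 1) ∧ t + s ∉ T} ≤
      ENNReal.ofReal (1 / (10 * ((j : ℝ) + 1))) := by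
  rw [← ae_restrict_iff' hT]
  filter_upwards [Besicovitch.ae_tendsto_measure_inter_div volume T] with t ht
  have hlt : ENNReal.ofReal (19 / 20) < 1 := by
    rw [← ENNReal.ofReal_one]; exact (ENNReal.ofReal_lt_ofReal_iff one_pos).2 (by norm_num)
  have hev := (tendsto_order.1 ht).1 _ hlt
  have hseq : Tendsto (fun j : ℕ => 1 / ((j : ℝ) + 1)) atTop (nhdsWithin 0 (Ioi 0)) :=
    tendsto_nhdsWithin_iff.2 ⟨tendsto_one_div_add_atTop_nhds_zero_nat,
      Eventually.of_forall fun j => by simp only [mem_Ioi]; positivity⟩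
  obtain ⟨k, hk⟩ := eventually_atTop.1 (hseq.eventually hev)
  refine ⟨k, fun j hj => ?_⟩
  have hj := hk j hj
  set h : ℝ := 1 / ((j : ℝ) + 1) with hh
  have hpos : 0 < h := by positivity
  have hB : volume (Metric.closedBall t h) = ENNReal.ofReal (2 * h) := Real.volume_closedBall t h
  have hBt : volume (Metric.closedBall t h) ≠ ⊤ := by rw [hB]; exact ENNReal.ofReal_ne_top
  rw [ENNReal.lt_div_iff_mul_lt (by simp [hB, hpos]) (by simp [hB]), hB,
    ← ENNReal.ofReal_mul (by norm_num)] at hj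
  have hsub : (fun s => t + s) ⁻¹' (Metric.closedBall t h \ T) ⊇ {s : ℝ | |s| < h ∧ t + s ∉ T} := by
    rintro s ⟨h1, h2⟩
    exact ⟨by simpa [Real.dist_eq] using h1.le, h2⟩
  have e1 : volume {s : ℝ | |s| < h ∧ t + s ∉ T} ≤ volume (Metric.closedBall t h \ T) := by
    refine (measure_mono hsub).trans_eq ?_
    exact measure_preimage_add volume t _
  refine e1.trans ?_
  have e2 := measure_sdiff_add_inter (μ := volume) (s := Metric.closedBall t h) hT
  rw [hB, inter_comm] at e2
  have hfin : volume (Metric.closedBall t h \ T) ≠ ⊤ := measure_ne_top_of_subset sdiff_subset hBt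
  have hfin2 : volume (T ∩ Metric.closedBall t h) ≠ ⊤ :=
    measure_ne_top_of_subset inter_subset_right hBt
  have e3 := congrArg ENNReal.toReal e2
  rw [ENNReal.toReal_add hfin hfin2, ENNReal.toReal_ofReal (by positivity)] at e3
  have e4 := (ENNReal.ofReal_lt_iff_lt_toReal (by positivity) hfin2).1 hj
  rw [← ENNReal.ofReal_toReal hfin]
  apply ENNReal.ofReal_le_ofReal
  have : 1 / (10 * ((j : ℝ) + 1)) = h / 10 := by rw [hh]; field_simp
  rw [this]
  linarith

theorem ae_exists_mem_denseLine [FiniteDimensional ℝ E] (μ : Measure E) [μ.IsAddHaarMeasure]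
    {S : Set E} (hS : MeasurableSet S) (e : E) :
    ∀ᵐ x ∂μ, x ∈ S → ∃ k, x ∈ denseLine S e k := by
  refine ae_of_ae_line μ e (p := fun x => x ∈ S → ∃ k, x ∈ denseLine S e k) ?_ ?_
  · have : MeasurableSet {x | ∃ k, x ∈ denseLine S e k} := by
      rw [ofPred_exists]
      exact .iUnion fun k => measurableSet_denseLine hS e k
    exact hS.imp this
  · refine Eventually.of_forall fun x => ?_
    have hT : MeasurableSet {s : ℝ | x + s • e ∈ S} := by
      have : Measurable fun s : ℝ => x + s • e := by fun_prop
      exact this hS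
    filter_upwards [ae_exists_dense_real hT] with t ht hx
    obtain ⟨k, hk⟩ := ht hx
    refine ⟨k, fun j hj => ?_⟩
    simpa [add_smul, add_assoc] using hk j hj

end Lines

section Covering

/-- Up to a null set, `P` is covered by countably many measurable sets with the property `φ`. -/
def AECovBy {α : Type*} [MeasurableSpace α] (μ : Measure α) (P : Set α) (φ : Set α → Prop) : Prop :=
  ∃ 𝒮 : Set (Set α), 𝒮.Countable ∧ (∀ S ∈ 𝒮, MeasurableSet S ∧ φ S) ∧
    ∀ᵐ x ∂μ, x ∈ P → ∃ S ∈ 𝒮, x ∈ S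

theorem AECovBy.refine {α : Type*} [MeasurableSpace α] {μ : Measure α} {P : Set α}
    {φ ψ : Set α → Prop} (h : AECovBy μ P φ) (h' : ∀ S, MeasurableSet S → φ S → AECovBy μ S ψ) :
    AECovBy μ P ψ := by
  obtain ⟨𝒮, hc, hS, hcov⟩ := h
  choose! 𝒯 hT using fun S hS' => h' S (hS S hS').1 (hS S hS').2
  refine ⟨⋃ S ∈ 𝒮, 𝒯 S, hc.biUnion fun S hS' => (hT S hS').1, ?_, ?_⟩
  · intro T hT'
    obtain ⟨S, hS', hTS⟩ := mem_iUnion₂.1 hT'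
    exact (hT S hS').2.1 T hTS
  · have := (ae_ball_iff hc).2 fun S hS' => (hT S hS').2.2
    filter_upwards [hcov, this] with x hx1 hx2 hxP
    obtain ⟨S, hS', hxS⟩ := hx1 hxP
    obtain ⟨T, hT', hxT⟩ := hx2 S hS' hxS
    exact ⟨T, mem_iUnion₂.2 ⟨S, hS', hT'⟩, hxT⟩

theorem aecovBy_of_iUnion {α ι : Type*} [Countable ι] [MeasurableSpace α] {μ : Measure α}
    {P : Set α} {φ : Set α → Prop} (S : ι → Set α) (hS : ∀ i, MeasurableSet (S i))
    (hφ : ∀ i, φ (S i)) (hcov : ∀ᵐ x ∂μ, x ∈ P → ∃ i, x ∈ S i) : AECovBy μ P φ := by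
  refine ⟨range S, countable_range S, ?_, ?_⟩
  · rintro _ ⟨i, rfl⟩
    exact ⟨hS i, hφ i⟩
  · simpa using hcov

theorem AECovBy.forall_finset {α ι : Type*} [MeasurableSpace α] {μ : Measure α} {P : Set α}
    (hP : MeasurableSet P) {ψ : ι → Set α → Prop} (hanti : ∀ i S T, T ⊆ S → ψ i S → ψ i T)
    (h : ∀ i, AECovBy μ P (ψ i)) (J : Finset ι) :
    AECovBy μ P (fun S => S ⊆ P ∧ ∀ i ∈ J, ψ i S) := by
  classical
  induction J using Finset.induction_on with
  | empty => exact aecovBy_of_iUnion (fun _ : Unit => P) (fun _ => hP) (by simp) (by simp)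
  | insert i J _ ih =>
    refine ih.refine fun S hS hψ => ?_
    obtain ⟨𝒯, hc, hT, hcov⟩ := h i
    have := hc.to_subtype
    refine aecovBy_of_iUnion (fun T : 𝒯 => (T : Set α) ∩ S) (fun T => (hT T T.2).1.inter hS)
      (fun T => ⟨inter_subset_right.trans hψ.1, fun l hl => ?_⟩) ?_
    · rcases Finset.mem_insert.1 hl with rfl | hl
      · exact hanti _ _ _ inter_subset_left (hT T T.2).2
      · exact hanti _ _ _ inter_subset_right (hψ.2 l hl)
    · filter_upwards [hcov] with x hx hxS
      obtain ⟨T, hT, hxT⟩ := hx (hψ.1 hxS)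
      exact ⟨⟨T, hT⟩, hxT, hxS⟩

end Covering

section Lipschitz

variable {E ι : Type*} [NormedAddCommGroup E] [NormedSpace ℝ E] [FiniteDimensional ℝ E]
  [MeasurableSpace E] [BorelSpace E]

/-- `w` is Lipschitz at small scale along pairs of points of `S` which differ only in the
coordinates of `J`. -/
def LipAlong (b : Module.Basis ι ℝ E) (w : E → ℝ) (J : Finset ι) (S : Set E) : Prop :=
  ∃ C δ : ℝ, 0 < δ ∧ ∀ x ∈ S, ∀ y ∈ S, (∀ i ∉ J, b.repr x i = b.repr y i) → ‖x - y‖ < δ →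
    |w x - w y| ≤ C * ‖x - y‖

theorem exists_nat_scale {ρ : ℝ} (h0 : 0 < ρ) (h1 : ρ ≤ 1) :
    ∃ j : ℕ, ρ ≤ 1 / ((j : ℝ) + 1) ∧ 1 / ((j : ℝ) + 1) ≤ 2 * ρ := by
  have hinv : 1 ≤ ρ⁻¹ := (one_le_inv₀ h0).2 h1
  obtain ⟨j, hj⟩ : ∃ j, ⌊ρ⁻¹⌋₊ = j + 1 :=
    Nat.exists_eq_succ_of_ne_zero (Nat.floor_pos.2 hinv).ne'
  have a1 := Nat.floor_le (zero_le_one.trans hinv)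
  have a2 := Nat.lt_floor_add_one ρ⁻¹
  rw [hj] at a1 a2
  push_cast at a1 a2
  have hj0 : (0 : ℝ) < (j : ℝ) + 1 := by positivity
  refine ⟨j, ?_, ?_⟩
  · rw [le_div_iff₀ hj0]
    calc ρ * ((j : ℝ) + 1) ≤ ρ * ρ⁻¹ := by gcongr
      _ = 1 := mul_inv_cancel₀ h0.ne'
  · rw [div_le_iff₀ hj0]
    have : 1 = ρ * ρ⁻¹ := (mul_inv_cancel₀ h0.ne').symm
    nlinarith [j.cast_nonneg (α := ℝ)]

omit [FiniteDimensional ℝ E] [MeasurableSpace E] [BorelSpace E] in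
/-- If two points lie in the dense part of `S` along `e`, then the corresponding lines meet `S` at
a common parameter, up to a prescribed shift `c`, which may be taken of size comparable to `ρ`. -/
theorem exists_common_parameter {S : Set E} {e x y : E} {k : ℕ} (hx : x ∈ denseLine S e k)
    (hy : y ∈ denseLine S e k) {ρ c : ℝ} (hρ : 0 < ρ) (hc : |c| ≤ ρ)
    (hk : 6 * ρ ≤ 1 / ((k : ℝ) + 1)) {p q : ℝ → Prop}
    (hp : ∀ᵐ s : ℝ, |s| < 6 * ρ → p s) (hq : ∀ᵐ s : ℝ, |s| < 6 * ρ → q s) :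
    ∃ s : ℝ, |s| < 2 * ρ ∧ x + s • e ∈ S ∧ y + (s + c) • e ∈ S ∧ p s ∧ q (s + c) := by
  have hk1 : 1 / ((k : ℝ) + 1) ≤ 1 := by
    rw [div_le_one (by positivity)]; linarith [k.cast_nonneg (α := ℝ)]
  obtain ⟨j, hj1, hj2⟩ := exists_nat_scale (ρ := 3 * ρ) (by positivity) (by linarith)
  have hjk : k ≤ j := by
    have : 1 / ((j : ℝ) + 1) ≤ 1 / ((k : ℝ) + 1) := by linarith
    have := (one_div_le_one_div (by positivity) (by positivity)).1 this
    exact_mod_cast (add_le_add_iff_right (1 : ℝ)).1 this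
  have hx := hx j hjk
  have hy := hy j hjk
  set h : ℝ := 1 / ((j : ℝ) + 1) with hh
  have hten : 1 / (10 * ((j : ℝ) + 1)) = h / 10 := by rw [hh]; field_simp
  rw [hten] at hx hy
  by_contra! hcon
  have hpn := ae_iff.1 hp
  have hqn := ae_iff.1 hq
  have hsub : Ioo (-(2 * ρ)) (2 * ρ) ⊆
      ({s : ℝ | |s| < h ∧ x + s • e ∉ S} ∪ {s | ¬ (|s| < 6 * ρ → p s)}) ∪
      ((fun s => s + c) ⁻¹' {s : ℝ | |s| < h ∧ y + s • e ∉ S} ∪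
        (fun s => s + c) ⁻¹' {s | ¬ (|s| < 6 * ρ → q s)}) := by
    intro s hs
    have hs1 : |s| < 2 * ρ := abs_lt.2 hs
    have hs2 : |s + c| < 3 * ρ := (abs_add_le s c).trans_lt (by linarith)
    by_contra hnot
    simp only [mem_union, mem_ofPred_eq, mem_preimage, not_or, not_and, not_not] at hnot
    obtain ⟨⟨n1, n2⟩, n3, n4⟩ := hnot
    exact hcon s hs1 (n1 (by linarith)) (n3 (by linarith)) (n2 (by linarith)) (n4 (by linarith))
  have hm := (measure_mono (μ := volume) hsub).trans ((measure_union_le _ _).trans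
    (add_le_add (measure_union_le _ _) (measure_union_le _ _)))
  rw [measure_preimage_add_right, measure_preimage_add_right, hpn, hqn, add_zero, add_zero,
    Real.volume_Ioo] at hm
  have hm2 := hm.trans (add_le_add hx hy)
  rw [← ENNReal.ofReal_add (by positivity) (by positivity),
    ENNReal.ofReal_le_ofReal_iff (by positivity)] at hm2
  linarith

omit [MeasurableSpace E] [BorelSpace E] in
theorem LipAlong.insert [DecidableEq ι] (b : Module.Basis ι ℝ E) {w : E → ℝ} {J : Finset ι}
    {S : Set E} (h : LipAlong b w J S) (i : ι) (k m : ℕ) :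
    LipAlong b w (insert i J) (S ∩ lipLine w (b i) m ∩ denseLine S (b i) k) := by
  obtain ⟨C, δ, hδ, hL⟩ := h
  let ℓ : E →L[ℝ] ℝ := (b.coord i).toContinuousLinearMap
  have hℓ : ∀ z, |b.repr z i| ≤ (‖ℓ‖ + 1) * ‖z‖ := fun z =>
    (ℓ.le_opNorm z).trans (by gcongr; linarith)
  set A : ℝ := ‖ℓ‖ + 1 with hA
  have hA0 : 0 < A := by positivity
  set B : ℝ := 1 + A * ‖b i‖ with hB
  have hB0 : 0 < B := by positivity
  refine ⟨|C| * B + 5 * m * A, min (δ / B) (1 / (6 * A) * min (1 / ((k : ℝ) + 1)) (1 / ((m : ℝ) + 1))),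
    by positivity, ?_⟩
  rintro x ⟨⟨hxS, hxm⟩, hxk⟩ y ⟨⟨hyS, hym⟩, hyk⟩ hxy hlt
  rcases (norm_nonneg (x - y)).eq_or_lt with h0 | hpos
  · rw [eq_comm, norm_eq_zero, sub_eq_zero] at h0
    simp [h0]
  set r := ‖x - y‖ with hr
  have hlt1 := hlt.trans_le (min_le_left _ _)
  have hlt2 := hlt.trans_le (min_le_right _ _)
  rw [lt_div_iff₀ hB0] at hlt1
  have hlt3 : 6 * (A * r) < min (1 / ((k : ℝ) + 1)) (1 / ((m : ℝ) + 1)) := by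
    have := mul_lt_mul_of_pos_left hlt2 (show 0 < 6 * A by positivity)
    rw [← mul_assoc, mul_one_div_cancel (by positivity), one_mul] at this
    linarith
  have hc : |b.repr (x - y) i| ≤ A * r := hℓ _
  have hρ : 0 < A * r := by positivity
  have hsm : 6 * (A * r) ≤ 1 / ((m : ℝ) + 1) := (hlt3.trans_le (min_le_right _ _)).le
  obtain ⟨s, hs, hsx, hsy, hpx, hqy⟩ := exists_common_parameter hxk hyk hρ hc
    (hlt3.trans_le (min_le_left _ _)).le
    (p := fun s => |w (x + s • b i) - w x| ≤ m * |s|)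
    (q := fun s => |w (y + s • b i) - w y| ≤ m * |s|)
    (by filter_upwards [hxm] with s h1 h2 using h1 (h2.trans_le hsm))
    (by filter_upwards [hym] with s h1 h2 using h1 (h2.trans_le hsm))
  set c := b.repr (x - y) i with hcdef
  have hdiff : x + s • b i - (y + (s + c) • b i) = (x - y) - c • b i := by
    rw [add_smul]; abel
  have hnorm : ‖x + s • b i - (y + (s + c) • b i)‖ ≤ B * r := by
    rw [hdiff]
    calc ‖(x - y) - c • b i‖ ≤ ‖x - y‖ + ‖c • b i‖ := norm_sub_le _ _
      _ = r + |c| * ‖b i‖ := by rw [norm_smul, Real.norm_eq_abs]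
      _ ≤ r + A * r * ‖b i‖ := by gcongr
      _ = B * r := by rw [hB]; ring
  have hmain := hL _ hsx _ hsy (by
    intro l hl
    rw [← sub_eq_zero, ← Finsupp.sub_apply, ← map_sub, hdiff]
    by_cases hli : l = i
    · subst hli
      simp [hcdef]
    · have := hxy l (by simp [hli, hl])
      simp [this, Ne.symm hli]) (hnorm.trans_lt (by linarith))
  have hs2 : |s + c| ≤ 3 * (A * r) := (abs_add_le s c).trans (by linarith)
  have hm0 : (0 : ℝ) ≤ m := m.cast_nonneg
  have e1 : m * |s| ≤ m * (2 * (A * r)) := by gcongr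
  have e2 : m * |s + c| ≤ m * (3 * (A * r)) := by gcongr
  have e3 : C * ‖x + s • b i - (y + (s + c) • b i)‖ ≤ |C| * (B * r) := by
    gcongr
    exact le_abs_self C
  have e4 : |w x - w y| ≤ |w (x + s • b i) - w x| +
      |w (x + s • b i) - w (y + (s + c) • b i)| + |w (y + (s + c) • b i) - w y| := by
    rw [abs_sub_comm (w (x + s • b i)) (w x)]
    have := abs_add_three (w x - w (x + s • b i))
      (w (x + s • b i) - w (y + (s + c) • b i)) (w (y + (s + c) • b i) - w y)
    simpa using this
  calc |w x - w y| ≤ m * (2 * (A * r)) + |C| * (B * r) + m * (3 * (A * r)) := by linarith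
    _ = (|C| * B + 5 * m * A) * r := by ring

end Lipschitz

section Differentiability

variable {E ι : Type*} [NormedAddCommGroup E] [NormedSpace ℝ E] [FiniteDimensional ℝ E]
  [MeasurableSpace E] [BorelSpace E]

theorem aecovBy_lipAlong (μ : Measure E) [μ.IsAddHaarMeasure] (b : Module.Basis ι ℝ E) {w : E → ℝ}
    (hw : Measurable w) {P : Set E} (hP : MeasurableSet P)
    (hD : ∀ x ∈ P, ∀ i, ∃ c, EssDerivAt w (b i) x c) (J : Finset ι) :
    AECovBy μ P (fun S => S ⊆ P ∧ LipAlong b w J S) := by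
  classical
  induction J using Finset.induction_on with
  | empty =>
    refine aecovBy_of_iUnion (fun _ : Unit => P) (fun _ => hP) (fun _ => ⟨subset_rfl, ?_⟩) (by simp)
    refine ⟨0, 1, one_pos, fun x _ y _ hxy _ => ?_⟩
    have : x = y := b.repr.injective (Finsupp.ext fun i => hxy i (by simp))
    simp [this]
  | insert i J _ ih =>
    refine ih.refine fun S hS hψ => ?_
    refine aecovBy_of_iUnion (fun q : ℕ × ℕ => S ∩ lipLine w (b i) q.2 ∩ denseLine S (b i) q.1)
      (fun q => (hS.inter (measurableSet_lipLine hw _ _)).inter (measurableSet_denseLine hS _ _))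
      (fun q => ⟨inter_subset_left.trans (inter_subset_left.trans hψ.1), hψ.2.insert b i _ _⟩) ?_
    filter_upwards [ae_exists_mem_denseLine μ hS (b i)] with x hx hxS
    obtain ⟨k, hk⟩ := hx hxS
    obtain ⟨c, hc⟩ := hD x (hψ.1 hxS) i
    obtain ⟨m, hm⟩ := hc.exists_mem_lipLine
    exact ⟨(k, m), ⟨hxS, hm⟩, hk⟩

theorem aecovBy_lipschitzOn [Finite ι] (μ : Measure E) [μ.IsAddHaarMeasure]
    (b : Module.Basis ι ℝ E) {w : E → ℝ} (hw : Measurable w) {P : Set E} (hP : MeasurableSet P)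
    (hD : ∀ x ∈ P, ∀ i, ∃ c, EssDerivAt w (b i) x c) :
    AECovBy μ P (fun S => S ⊆ P ∧ ∃ K, LipschitzOnWith K w S) := by
  have := Fintype.ofFinite ι
  refine (aecovBy_lipAlong μ b hw hP hD Finset.univ).refine ?_
  rintro S hS ⟨hSP, C, δ, hδ, hL⟩
  have hdense := TopologicalSpace.exists_countable_dense E
  obtain ⟨s, hsc, hs⟩ := hdense
  have := hsc.to_subtype
  refine aecovBy_of_iUnion (fun z : s => S ∩ Metric.ball (z : E) (δ / 2))
    (fun z => hS.inter measurableSet_ball) (fun z => ⟨inter_subset_left.trans hSP, C.toNNReal, ?_⟩)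
    (Eventually.of_forall fun x hx => ?_)
  · refine LipschitzOnWith.of_dist_le_mul fun x hx y hy => ?_
    have h1 : ‖x - y‖ < δ := by
      rw [← dist_eq_norm]
      have := dist_triangle_right x y (z : E)
      have h1 := Metric.mem_ball.1 hx.2
      have h2 := Metric.mem_ball.1 hy.2
      linarith
    rw [Real.dist_eq, dist_eq_norm]
    refine (hL x hx.1 y hy.1 (by simp) h1).trans ?_
    gcongr
    exact Real.le_coe_toNNReal C
  · obtain ⟨z, hz, hxz⟩ := hs.exists_dist_lt x (half_pos hδ)
    exact ⟨⟨z, hz⟩, hx, hxz⟩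

omit [FiniteDimensional ℝ E] [MeasurableSpace E] [BorelSpace E] in
/-- At a density point of `S` along `e`, the essential derivative of `w` in the direction `e`
coincides with the derivative of any function which agrees with `w` on `S`. -/
theorem EssDerivAt.eq_of_eqOn {w F : E → ℝ} {S : Set E} (hwF : EqOn w F S) {e x : E} (hx : x ∈ S)
    {k : ℕ} (hk : x ∈ denseLine S e k) {c : ℝ} (hc : EssDerivAt w e x c) {L : E →L[ℝ] ℝ}
    (hF : HasFDerivAt F L x) : L e = c := by
  by_contra hne
  have hpos : 0 < |L e - c| := abs_pos.2 (sub_ne_zero.2 hne)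
  obtain ⟨n, hn⟩ := exists_nat_one_div_lt (half_pos hpos)
  obtain ⟨m, hm⟩ := hc n
  have hline : HasDerivAt (fun s : ℝ => F (x + s • e)) (L e) 0 := by
    have h1 : HasDerivAt (fun s : ℝ => x + s • e) e 0 := by
      simpa using ((hasDerivAt_id (0 : ℝ)).smul_const e).const_add x
    exact HasFDerivAt.comp_hasDerivAt (0 : ℝ) (by simpa using hF) h1
  have hev := (hasDerivAt_iff_isLittleO.1 hline).def (half_pos hpos)
  obtain ⟨η, hη, hball⟩ := Metric.eventually_nhds_iff.1 hev
  obtain ⟨j, hj⟩ := exists_nat_one_div_lt hη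
  set N := max (max m k) j with hN
  set h : ℝ := 1 / ((N : ℝ) + 1) with hh
  have hpos' : 0 < h := by positivity
  have hd := hk N ((le_max_right _ _).trans (le_max_left _ _))
  have hten : 1 / (10 * ((N : ℝ) + 1)) = h / 10 := by rw [hh]; field_simp
  rw [hten] at hd
  have hhj : h < η := by
    refine lt_of_le_of_lt ?_ hj
    exact one_div_le_one_div_of_le (by positivity) (by gcongr; exact le_max_right _ _)
  have hhm : h ≤ 1 / ((m : ℝ) + 1) :=
    one_div_le_one_div_of_le (by positivity)
      (by gcongr; exact (le_max_left _ _).trans (le_max_left _ _))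
  have hsub : Ioo 0 h ⊆ {s : ℝ | |s| < h ∧ x + s • e ∉ S} ∪
      {s : ℝ | ¬ (|s| < 1 / ((m : ℝ) + 1) →
        |w (x + s • e) - w x - s * c| ≤ |s| / (n + 1))} := by
    intro s hs
    by_contra hnot
    simp only [mem_union, mem_ofPred_eq, not_or, not_and, not_not] at hnot
    obtain ⟨n1, n2⟩ := hnot
    have hsabs : |s| = s := abs_of_pos hs.1
    have hsh : |s| < h := by rw [hsabs]; exact hs.2
    have hxs := n1 hsh
    have i1 := n2 (hsh.trans_le hhm)
    have i2 := hball (y := s) (by simpa using hsh.trans hhj)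
    rw [hwF hxs, hwF hx] at i1
    simp only [zero_smul, add_zero, sub_zero, smul_eq_mul, Real.norm_eq_abs] at i2
    have i3 : |s * (L e - c)| ≤ |F (x + s • e) - F x - s * c| +
        |F (x + s • e) - F x - s * L e| := by
      have := abs_sub (F (x + s • e) - F x - s * c) (F (x + s • e) - F x - s * L e)
      rwa [show F (x + s • e) - F x - s * c - (F (x + s • e) - F x - s * L e) =
        s * (L e - c) by ring] at this
    rw [abs_mul, hsabs] at i3
    rw [hsabs] at i1 i2
    have i4 : s / ((n : ℝ) + 1) < s * (|L e - c| / 2) := by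
      rw [div_eq_mul_one_div]
      exact mul_lt_mul_of_pos_left hn hs.1
    linarith
  have hmeas := (measure_mono (μ := volume) hsub).trans (measure_union_le _ _)
  rw [ae_iff.1 hm, add_zero, Real.volume_Ioo] at hmeas
  have := hmeas.trans hd
  rw [ENNReal.ofReal_le_ofReal_iff (by positivity)] at this
  linarith

theorem aecovBy_hasFDerivWithinAt [Finite ι] (μ : Measure E) [μ.IsAddHaarMeasure]
    (b : Module.Basis ι ℝ E) {w : E → ℝ} (hw : Measurable w) {P : Set E} (hP : MeasurableSet P)
    {D : E → E →L[ℝ] ℝ} (hD : ∀ x ∈ P, ∀ i, EssDerivAt w (b i) x (D x (b i))) :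
    AECovBy μ P (fun S => ∀ x ∈ S, HasFDerivWithinAt w (D x) S x) := by
  refine (aecovBy_lipschitzOn μ b hw hP fun x hx i => ⟨_, hD x hx i⟩).refine ?_
  rintro S hS ⟨hSP, K, hK⟩
  obtain ⟨F, hF, hwF⟩ := hK.extend_real
  let T : Set E := S ∩ {x | DifferentiableAt ℝ F x} ∩ ⋂ i, ⋃ k, denseLine S (b i) k
  have hT : MeasurableSet T := (hS.inter (measurableSet_of_differentiableAt ℝ F)).inter
    (.iInter fun i => .iUnion fun k => measurableSet_denseLine hS _ _)
  refine aecovBy_of_iUnion (fun _ : Unit => T) (fun _ => hT) (fun _ => ?_) ?_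
  · rintro x ⟨⟨hxS, hxF⟩, hxd⟩
    have hfd := hxF.hasFDerivAt
    have : fderiv ℝ F x = D x := by
      refine ContinuousLinearMap.coe_injective (b.ext fun i => ?_)
      obtain ⟨k, hk⟩ := mem_iUnion.1 (mem_iInter.1 hxd i)
      exact (hD x (hSP hxS) i).eq_of_eqOn hwF hxS hk hfd
    rw [this] at hfd
    exact hfd.hasFDerivWithinAt.congr (fun y hy => hwF hy.1.1) (hwF hxS)
  · filter_upwards [hF.ae_differentiableAt (μ := μ),
      ae_all_iff.2 fun i => ae_exists_mem_denseLine μ hS (b i)] with x h1 h2 hxS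
    exact ⟨(), ⟨hxS, h1⟩, mem_iInter.2 fun i => mem_iUnion.2 (h2 i hxS)⟩

/-- Preimages of null sets are null, among the points where the derivative is surjective. -/
theorem measure_preimage_null_of_surjective {F : Type*} [NormedAddCommGroup F] [NormedSpace ℝ F]
    [FiniteDimensional ℝ F] [MeasurableSpace F] [BorelSpace F] (μ : Measure E)
    [μ.IsAddHaarMeasure] (ν : Measure F) [ν.IsAddHaarMeasure] {U : E → F} {D : E → E →L[ℝ] F}
    {S : Set E} (hU : ∀ x ∈ S, HasFDerivWithinAt U (D x) S x)
    (hsurj : ∀ x ∈ S, Function.Surjective (D x)) {B : Set F} (hB : MeasurableSet B)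
    (hB0 : ν B = 0) : μ (S ∩ U ⁻¹' B) = 0 := by
  have hdet : ((1 / 2 : NNReal) : ENNReal) <
      ENNReal.ofReal |(ContinuousLinearMap.id ℝ E).det| := by
    have : (ContinuousLinearMap.id ℝ E).det = 1 := LinearMap.det_id
    rw [this, abs_one, ENNReal.ofReal_one]
    exact_mod_cast (by norm_num : (1 / 2 : NNReal) < 1)
  obtain ⟨δ, hδ, hδ0⟩ := ((mul_le_addHaar_image_of_lt_det μ _ hdet).and self_mem_nhdsWithin).exists
  have hδ0 : 0 < δ := hδ0
  have hR : ∀ A : E →L[ℝ] F, ∃ R : F →L[ℝ] E, Function.Surjective A →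
      A.comp R = ContinuousLinearMap.id ℝ F := by
    intro A
    by_cases hA : Function.Surjective A
    · obtain ⟨R, hR⟩ := A.exists_rightInverse_of_surjective (LinearMap.range_eq_top.2 hA)
      exact ⟨R, fun _ => hR⟩
    · exact ⟨0, fun h => absurd h hA⟩
  choose R hR using hR
  obtain ⟨t, A, -, -, hcov, happ, hA⟩ :=
    exists_partition_approximatesLinearOn_of_hasFDerivWithinAt U S D hU
      (fun A => δ / (‖R A‖₊ + 1)) (fun A => by positivity)
  rcases S.eq_empty_or_nonempty with rfl | hne
  · simp
  have hpiece : ∀ n, μ (S ∩ t n ∩ U ⁻¹' B) = 0 := by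
    intro n
    obtain ⟨y, hy, hAy⟩ := hA hne n
    have hAs : Function.Surjective (A n) := hAy ▸ hsurj y hy
    have hAR : ∀ v, A n (R (A n) v) = v := fun v => congrArg (fun L => L v) (hR (A n) hAs)
    let G : E → E := fun x => x + R (A n) (U x - A n x)
    have hG : ApproximatesLinearOn G (ContinuousLinearMap.id ℝ E) (S ∩ t n ∩ U ⁻¹' B) δ := by
      intro x hx y hy
      have h1 := happ n x hx.1 y hy.1
      have h2 : G x - G y - ContinuousLinearMap.id ℝ E (x - y) =
          R (A n) (U x - U y - A n (x - y)) := by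
        simp only [G, map_sub, ContinuousLinearMap.id_apply]
        abel
      rw [h2]
      calc ‖R (A n) (U x - U y - A n (x - y))‖
          ≤ ‖R (A n)‖ * (((δ / (‖R (A n)‖₊ + 1) : NNReal) : ℝ) * ‖x - y‖) :=
            (ContinuousLinearMap.le_opNorm _ _).trans (by gcongr)
        _ = (‖R (A n)‖ / (‖R (A n)‖ + 1)) * (δ * ‖x - y‖) := by
            push_cast; ring
        _ ≤ 1 * (δ * ‖x - y‖) := by
            gcongr
            rw [div_le_one (by positivity)]
            linarith
        _ = δ * ‖x - y‖ := one_mul _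
    have himg : G '' (S ∩ t n ∩ U ⁻¹' B) ⊆ A n ⁻¹' B := by
      rintro _ ⟨x, hx, rfl⟩
      have : A n (G x) = U x := by
        simp only [G, map_add, hAR]
        abel
      rw [mem_preimage, this]
      exact hx.2
    have hnull : μ (A n ⁻¹' B) = 0 := by
      have := (ae_comp_linearMap_mem_iff (A n : E →ₗ[ℝ] F) μ ν hAs hB.compl).2
        (compl_mem_ae_iff.2 hB0)
      rw [ae_iff] at this
      simp only [mem_compl_iff, not_not] at this
      exact this
    have := (hδ _ _ hG).trans (measure_mono himg)
    rw [hnull] at this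
    simpa using this
  refine measure_mono_null (fun x hx => ?_) (measure_iUnion_null hpiece)
  obtain ⟨n, hn⟩ := mem_iUnion.1 (hcov hx.1)
  exact mem_iUnion.2 ⟨n, ⟨hx.1, hn⟩, hx.2⟩

/-- A map with essential partial derivatives is absolutely continuous on the set where its
differential is surjective. -/
theorem ae_notMem_of_essDerivAt [Finite ι] (μ : Measure E) [μ.IsAddHaarMeasure]
    (b : Module.Basis ι ℝ E) {κ : Type*} [Fintype κ] {U : κ → E → ℝ} (hU : ∀ a, Measurable (U a))
    {P : Set E} (hP : MeasurableSet P) {D : κ → E → E →L[ℝ] ℝ}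
    (hD : ∀ x ∈ P, ∀ a i, EssDerivAt (U a) (b i) x (D a x (b i)))
    {B : Set (κ → ℝ)} (hB : MeasurableSet B) (hB0 : volume B = 0) :
    ∀ᵐ x ∂μ, x ∈ P → Function.Surjective (ContinuousLinearMap.pi fun a => D a x) →
      (fun a => U a x) ∉ B := by
  obtain ⟨𝒮, hc, hS, hcov⟩ := AECovBy.forall_finset hP
    (ψ := fun a S => ∀ x ∈ S, HasFDerivWithinAt (U a) (D a x) S x)
    (fun a S T hTS h x hx => (h x (hTS hx)).mono hTS)
    (fun a => aecovBy_hasFDerivWithinAt μ b (hU a) hP fun x hx i => hD x hx a i) Finset.univ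
  have hnull : ∀ S ∈ 𝒮, ∀ᵐ x ∂μ, x ∈ S →
      Function.Surjective (ContinuousLinearMap.pi fun a => D a x) → (fun a => U a x) ∉ B := by
    intro S hSS
    have h0 := measure_preimage_null_of_surjective μ (volume : Measure (κ → ℝ))
      (U := fun x a => U a x) (D := fun x => ContinuousLinearMap.pi fun a => D a x)
      (S := S ∩ {x | Function.Surjective (ContinuousLinearMap.pi fun a => D a x)})
      (fun x hx => hasFDerivWithinAt_pi.2 fun a =>
        ((hS S hSS).2.2 a (Finset.mem_univ a) x hx.1).mono inter_subset_left)
      (fun x hx => hx.2) hB hB0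
    filter_upwards [compl_mem_ae_iff.2 h0] with x hx h1 h2 h3
    exact hx ⟨⟨h1, h2⟩, h3⟩
  filter_upwards [hcov, (ae_ball_iff hc).2 hnull] with x hx1 hx2 hxP
  obtain ⟨S, hSS, hxS⟩ := hx1 hxP
  exact hx2 S hSS hxS

end Differentiability

section Sections

theorem isOpen_Rset (ρ : ℝ → ℝ) : IsOpen (Rset ρ) := by
  refine Metric.isOpen_iff.2 fun t ht => ?_
  obtain ⟨ε, hε, hint⟩ := ht
  refine ⟨ε / 2, by positivity, fun s hs => ⟨ε / 2, by positivity, hint.mono_set ?_⟩⟩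
  have := abs_lt.1 (Real.dist_eq s t ▸ Metric.mem_ball.1 hs)
  exact Ioo_subset_Ioo (by linarith) (by linarith)

/-- A function with a version whose increments on the intervals of an open set `R` are the
integrals of `g` has essential derivative `g` almost everywhere on `R`. -/
theorem ae_essDerivAt_of_eq_integral {R : Set ℝ} (hR : IsOpen R) {w g v : ℝ → ℝ}
    (hv : ∀ᵐ s : ℝ, s ∈ R → v s = w s)
    (hAC : ∀ a b : ℝ, a ≤ b → Icc a b ⊆ R →
      IntegrableOn g (Icc a b) volume ∧ v b - v a = ∫ s in a..b, g s) :
    ∀ᵐ s : ℝ, s ∈ R → EssDerivAt w (1 : ℝ) s (g s) := by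
  have hder : ∀ q : ℚ × ℚ, ∀ᵐ s : ℝ, (q.1 : ℝ) ≤ q.2 → Icc (q.1 : ℝ) q.2 ⊆ R →
      s ∈ Ioo (q.1 : ℝ) q.2 → HasDerivAt v (g s) s := by
    rintro ⟨a, b⟩
    by_cases hab : (a : ℝ) ≤ b ∧ Icc (a : ℝ) b ⊆ R
    · have hint : IntervalIntegrable g volume a b :=
        (intervalIntegrable_iff_integrableOn_Icc_of_le hab.1).2 (hAC a b hab.1 hab.2).1
      filter_upwards [hint.ae_hasDerivAt_integral] with s hs _ _ hsab
      rw [uIcc_of_le hab.1] at hs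
      have h1 := (hs (Ioo_subset_Icc_self hsab) a (left_mem_Icc.2 hab.1)).const_add (v a)
      refine h1.congr_of_eventuallyEq ?_
      filter_upwards [Ioo_mem_nhds hsab.1 hsab.2] with t ht
      have := (hAC a t ht.1.le ((Icc_subset_Icc_right ht.2.le).trans hab.2)).2
      linarith
    · exact Eventually.of_forall fun s h1 h2 => absurd ⟨h1, h2⟩ hab
  filter_upwards [hv, ae_all_iff.2 hder] with s hs hds hsR
  obtain ⟨ε, hε, hball⟩ := Metric.isOpen_iff.1 hR s hsR
  obtain ⟨a, ha1, ha2⟩ := exists_rat_btwn (show s - ε < s by linarith)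
  obtain ⟨b, hb1, hb2⟩ := exists_rat_btwn (show s < s + ε by linarith)
  have hd : HasDerivAt v (g s) s := hds (a, b) (ha2.trans hb1).le
    (fun t ht => hball (by
      rw [Real.ball_eq_Ioo]; exact ⟨ha1.trans_le ht.1, ht.2.trans_lt hb2⟩)) ⟨ha2, hb1⟩
  intro n
  have hev := (hasDerivAt_iff_isLittleO_nhds_zero.1 hd).def
    (show (0 : ℝ) < 1 / ((n : ℝ) + 1) by positivity)
  obtain ⟨η, hη, hη'⟩ := Metric.eventually_nhds_iff.1 hev
  obtain ⟨m, hm⟩ := exists_nat_one_div_lt (lt_min hη hε)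
  refine ⟨m, ?_⟩
  have hshift := (measurePreserving_add_left volume s).quasiMeasurePreserving.ae hv
  filter_upwards [hshift] with t ht htm
  have hlt := htm.trans hm
  have hstR : s + t ∈ R := hball (by
    simpa [Real.dist_eq] using hlt.trans_le (min_le_right _ _))
  have h1 := hη' (y := t) (by simpa [Real.dist_eq] using hlt.trans_le (min_le_left _ _))
  rw [smul_eq_mul, mul_one, ← ht hstR, ← hs hsR]
  simp only [smul_eq_mul, Real.norm_eq_abs] at h1
  rwa [one_div_mul_eq_div] at h1

theorem ae_lintegral_line_lt_top {r : ℕ} {f : (Fin r → ℝ) → ENNReal} (hf : Measurable f)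
    (hfin : ∫⁻ x, f x ≠ ⊤) (j : Fin r) :
    ∀ᵐ x, ∫⁻ t : ℝ, f (x + t • Pi.single j 1) < ⊤ := by
  let W : ℝ → ENNReal := fun s => ENNReal.ofReal ((1 + s ^ 2)⁻¹)
  have hW : Measurable W := by fun_prop
  have hWfin : ∫⁻ s, W s ≠ ⊤ := integrable_inv_one_add_sq.lintegral_lt_top.ne
  have hline : Measurable fun z : (Fin r → ℝ) × ℝ => z.1 + z.2 • (Pi.single j 1 : Fin r → ℝ) := by
    fun_prop
  have hfl : Measurable fun z : (Fin r → ℝ) × ℝ =>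
      f (z.1 + z.2 • (Pi.single j 1 : Fin r → ℝ)) := hf.comp hline
  have hI : Measurable fun x : Fin r → ℝ => ∫⁻ t : ℝ, f (x + t • Pi.single j 1) :=
    hfl.lintegral_prod_right'
  have key : ∫⁻ x : Fin r → ℝ, W (x j) * ∫⁻ t : ℝ, f (x + t • Pi.single j 1) =
      (∫⁻ x, f x) * ∫⁻ s, W s := by
    calc ∫⁻ x : Fin r → ℝ, W (x j) * ∫⁻ t : ℝ, f (x + t • Pi.single j 1)
        = ∫⁻ x : Fin r → ℝ, ∫⁻ t : ℝ, W (x j) * f (x + t • Pi.single j 1) := by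
          refine lintegral_congr fun x => ?_
          rw [lintegral_const_mul]
          exact hfl.comp measurable_prodMk_left
      _ = ∫⁻ t : ℝ, ∫⁻ x : Fin r → ℝ, W (x j) * f (x + t • Pi.single j 1) := by
          refine lintegral_lintegral_swap (Measurable.aemeasurable ?_)
          exact (hW.comp (by fun_prop : Measurable fun z : (Fin r → ℝ) × ℝ => z.1 j)).mul hfl
      _ = ∫⁻ t : ℝ, ∫⁻ x : Fin r → ℝ, W (x j - t) * f x := by
          refine lintegral_congr fun t => ?_
          rw [← lintegral_add_right_eq_self (fun x : Fin r → ℝ => W (x j - t) * f x)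
            (t • Pi.single j 1)]
          simp
      _ = ∫⁻ x : Fin r → ℝ, ∫⁻ t : ℝ, W (x j - t) * f x := by
          refine (lintegral_lintegral_swap (Measurable.aemeasurable ?_)).symm
          exact (hW.comp (by fun_prop : Measurable fun z : (Fin r → ℝ) × ℝ => z.1 j - z.2)).mul
            (hf.comp measurable_fst)
      _ = ∫⁻ x : Fin r → ℝ, f x * ∫⁻ s, W s := by
          refine lintegral_congr fun x => ?_
          rw [lintegral_mul_const _ (by fun_prop), lintegral_sub_left_eq_self W (x j), mul_comm]
      _ = (∫⁻ x, f x) * ∫⁻ s, W s := lintegral_mul_const _ hf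
  have hlt := ae_lt_top (μ := (volume : Measure (Fin r → ℝ)))
    (f := fun x : Fin r → ℝ => W (x j) * ∫⁻ t : ℝ, f (x + t • Pi.single j 1))
    ((hW.comp (measurable_pi_apply j)).mul hI) (by rw [key]; exact ENNReal.mul_ne_top hfin hWfin)
  filter_upwards [hlt] with x hx
  refine lt_top_iff_ne_top.2 fun htop => ?_
  have hW0 : W (x j) ≠ 0 := by
    simp only [W, ne_eq, ENNReal.ofReal_eq_zero, not_le]
    positivity
  rw [htop, ENNReal.mul_top hW0] at hx
  exact lt_irrefl _ hx

theorem update_eq_add_smul_single {r : ℕ} (x : Fin r → ℝ) (j : Fin r) (s : ℝ) :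
    x + s • Pi.single j 1 = Function.update x j (x j + s) := by
  ext l
  by_cases h : l = j
  · subst h; simp
  · simp [h]

theorem HG.ae_section_mem_Rset {r : ℕ} {k : (Fin r → ℝ) → ℝ}
    {ξ : Fin r → Fin r → (Fin r → ℝ) → ℝ} (h : HG r k ξ) (hk : Integrable k) (j : Fin r) :
    ∀ᵐ x : Fin r → ℝ, ∀ᵐ s : ℝ, k (Function.update x j s) ≠ 0 →
      s ∈ Rset (fun t => k (Function.update x j t)) := by
  have hfin : ∫⁻ x, ENNReal.ofReal (k x) ≠ ⊤ := hk.lintegral_lt_top.ne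
  filter_upwards [h.hamza j, ae_lintegral_line_lt_top h.k_meas.ennreal_ofReal hfin j] with x hx hfx
  have hmeas : Measurable fun s : ℝ => k (Function.update x j s) :=
    h.k_meas.comp (measurable_update x)
  have hint : Integrable fun s : ℝ => k (Function.update x j s) := by
    refine ⟨hmeas.aestronglyMeasurable, ?_⟩
    rw [hasFiniteIntegral_iff_ofReal (Eventually.of_forall fun s => h.k_nonneg _)]
    simp_rw [update_eq_add_smul_single] at hfx
    rwa [lintegral_add_left_eq_self
      (fun s => ENNReal.ofReal (k (Function.update x j s))) (x j)] at hfx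
  have h0 : 0 ≤ fun s : ℝ => k (Function.update x j s) := fun s => h.k_nonneg _
  rcases (integral_nonneg h0).eq_or_lt with heq | hlt
  · have := (integral_eq_zero_iff_of_nonneg h0 hint).1 heq.symm
    filter_upwards [this] with s hs hne
    exact absurd hs hne
  · filter_upwards [hx hlt] with s hs hne
    by_contra hnot
    exact hne (hs hnot)

theorem MemDom.ae_essDerivAt {r : ℕ} {k : (Fin r → ℝ) → ℝ}
    {ξ : Fin r → Fin r → (Fin r → ℝ) → ℝ} (h : HG r k ξ) (hk : Integrable k)
    {u : (Fin r → ℝ) → ℝ} {du : Fin r → (Fin r → ℝ) → ℝ} (hu : MemDom r k ξ u du) (j : Fin r) :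
    ∀ᵐ x : Fin r → ℝ, k x ≠ 0 → EssDerivAt u (Pi.single j 1) x (du j x) := by
  have hk0 : MeasurableSet {x | k x ≠ 0} := (h.k_meas (measurableSet_singleton 0)).compl
  refine ae_of_ae_line volume (Pi.single j 1)
    (hk0.imp (measurableSet_essDerivAt hu.meas (hu.du_meas j) _)) ?_
  filter_upwards [h.ae_section_mem_Rset hk j, hu.sectionsAC j] with x hx hsec
  obtain ⟨v, hv, hAC⟩ := hsec
  have hess := ae_essDerivAt_of_eq_integral (isOpen_Rset _) hv hAC
  have hshift := (measurePreserving_add_left volume (x j)).quasiMeasurePreserving.ae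
    (hx.and hess)
  filter_upwards [hshift] with t ht hne
  rw [update_eq_add_smul_single] at hne ⊢
  intro n
  obtain ⟨m, hm⟩ := ht.2 (ht.1 hne) n
  refine ⟨m, ?_⟩
  filter_upwards [hm] with s hs hlt
  simpa [update_eq_add_smul_single] using hs hlt

end Sections

section Product

theorem ae_pi_of_ae_update {ι : Type*} [Fintype ι] [DecidableEq ι] {α : ι → Type*}
    [∀ i, MeasurableSpace (α i)] (ν : ∀ i, Measure (α i)) [∀ i, IsProbabilityMeasure (ν i)]
    (i : ι) {p : (∀ i, α i) → Prop} (hp : MeasurableSet {x | p x})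
    (h : ∀ᵐ x ∂Measure.pi ν, ∀ᵐ y ∂ν i, p (Function.update x i y)) :
    ∀ᵐ x ∂Measure.pi ν, p x := by
  have hmeas : Measurable fun z : (∀ i, α i) × α i => Function.update z.1 i z.2 := by
    refine measurable_pi_iff.2 fun l => ?_
    by_cases hl : l = i
    · subst hl; simpa using measurable_snd
    · simp only [Function.update_of_ne hl]
      exact (measurable_pi_apply l).comp measurable_fst
  have hmap : Measure.pi ν =
      Measure.map (fun z : (∀ i, α i) × α i => Function.update z.1 i z.2)
        ((Measure.pi ν).prod (ν i)) := by
    refine Measure.pi_eq fun s hs => ?_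
    rw [Measure.map_apply hmeas (.univ_pi hs)]
    have : (fun z : (∀ i, α i) × α i => Function.update z.1 i z.2) ⁻¹' univ.pi s =
        (univ.pi (Function.update s i univ)) ×ˢ s i := by
      ext ⟨x, y⟩
      simp only [mem_preimage, Set.mem_pi, mem_univ, true_implies, mem_prod]
      constructor
      · intro hxy
        refine ⟨fun l => ?_, by simpa using hxy i⟩
        by_cases hl : l = i
        · subst hl; simp
        · simpa [hl] using hxy l
      · rintro ⟨h1, h2⟩ l
        by_cases hl : l = i
        · subst hl; simpa using h2
        · simpa [hl] using h1 l
    rw [this, Measure.prod_prod, Measure.pi_pi,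
      ← Finset.prod_erase_mul _ _ (Finset.mem_univ i),
      ← Finset.prod_erase_mul Finset.univ (fun l => ν l (s l)) (Finset.mem_univ i)]
    simp only [Function.update_self, measure_univ, mul_one]
    congr 1
    refine Finset.prod_congr rfl fun l hl => ?_
    rw [Function.update_of_ne (Finset.ne_of_mem_erase hl)]
  rw [hmap, ae_map_iff hmeas.aemeasurable hp]
  exact (Measure.ae_prod_iff_ae_ae
    (p := fun z : (∀ i, α i) × α i => p (Function.update z.1 i z.2)) (hmeas hp)).2 h

theorem prodMeasure_eq_withDensity {n r : ℕ} {k : Fin n → (Fin r → ℝ) → ℝ}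
    (h0 : ∀ i y, 0 ≤ k i y) (hint : ∀ i, Integrable (k i)) :
    prodMeasure n r k =
      volume.withDensity fun x : Fin n → Fin r → ℝ => ENNReal.ofReal (∏ i, k i (x i)) := by
  have : ∀ i, IsFiniteMeasure
      ((volume : Measure (Fin r → ℝ)).withDensity fun y => ENNReal.ofReal (k i y)) :=
    fun i => isFiniteMeasure_withDensity_ofReal (hint i).2
  refine Measure.pi_eq fun s hs => ?_
  have hind : ∀ x : Fin n → Fin r → ℝ,
      (univ.pi s).indicator (fun x => ENNReal.ofReal (∏ i, k i (x i))) x =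
        ENNReal.ofReal (∏ i, (s i).indicator (k i) (x i)) := by
    intro x
    by_cases hx : x ∈ univ.pi s
    · rw [indicator_of_mem hx]
      congr 1
      exact Finset.prod_congr rfl fun i _ => (indicator_of_mem (hx i (mem_univ i)) _).symm
    · rw [indicator_of_notMem hx]
      obtain ⟨i, hi⟩ : ∃ i, x i ∉ s i := by simpa [Set.mem_pi] using hx
      rw [Finset.prod_eq_zero (Finset.mem_univ i) (indicator_of_notMem hi _), ENNReal.ofReal_zero]
  have hnn : ∀ i y, 0 ≤ (s i).indicator (k i) y := fun i y =>
    indicator_nonneg (fun y _ => h0 i y) y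
  have hinti : ∀ i, Integrable ((s i).indicator (k i)) := fun i => (hint i).indicator (hs i)
  rw [withDensity_apply _ (.univ_pi hs), ← lintegral_indicator (.univ_pi hs)]
  simp_rw [hind]
  rw [volume_pi, ← ofReal_integral_eq_lintegral_ofReal (Integrable.fintype_prod hinti)
    (Eventually.of_forall fun x => Finset.prod_nonneg fun i _ => hnn i _),
    integral_fintype_prod_eq_prod, ENNReal.ofReal_prod_of_nonneg
      fun i _ => integral_nonneg (hnn i)]
  refine Finset.prod_congr rfl fun i _ => ?_
  rw [withDensity_apply _ (hs i), ← lintegral_indicator (hs i),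
    ofReal_integral_eq_lintegral_ofReal (hinti i) (Eventually.of_forall (hnn i))]
  refine lintegral_congr fun y => ?_
  by_cases hy : y ∈ s i <;> simp [hy]

/-- The differential with partial derivatives `c i j`. -/
def blockDifferential {n r : ℕ} (c : Fin n → Fin r → ℝ) : (Fin n → Fin r → ℝ) →L[ℝ] ℝ :=
  ∑ i, ∑ j, c i j •
    (ContinuousLinearMap.proj (R := ℝ) (φ := fun _ : Fin r => ℝ) j).comp
      (ContinuousLinearMap.proj (R := ℝ) (φ := fun _ : Fin n => Fin r → ℝ) i)

theorem blockDifferential_single {n r : ℕ} (c : Fin n → Fin r → ℝ) (i : Fin n) (j : Fin r) :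
    blockDifferential c (Pi.single i (Pi.single j 1)) = c i j := by
  simp only [blockDifferential, _root_.sum_apply, _root_.smul_apply,
    ContinuousLinearMap.comp_apply, ContinuousLinearMap.proj_apply, smul_eq_mul]
  rw [Finset.sum_eq_single i (fun l _ hl => by simp [hl]) (by simp),
    Finset.sum_eq_single j (fun l _ hl => by simp [hl]) (by simp)]
  simp

/-- A Gram matrix with nonzero determinant comes from linearly independent differentials. -/
theorem surjective_blockDifferential_of_det_ne_zero {n r d : ℕ}
    (A : Fin n → Fin r → Fin r → ℝ) (c : Fin d → Fin n → Fin r → ℝ)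
    (h : (Matrix.of fun a b : Fin d => ∑ i, ∑ j, ∑ l, A i j l * c a i j * c b i l).det ≠ 0) :
    Function.Surjective (ContinuousLinearMap.pi fun a => blockDifferential (c a)) := by
  by_contra hns
  set L := ContinuousLinearMap.pi fun a => blockDifferential (c a) with hL
  have hlt : LinearMap.range (L : (Fin n → Fin r → ℝ) →ₗ[ℝ] (Fin d → ℝ)) < ⊤ :=
    lt_top_iff_ne_top.2 fun htop => hns (LinearMap.range_eq_top.1 htop)
  obtain ⟨f, hf, hker⟩ := Submodule.exists_le_ker_of_lt_top _ hlt
  refine h (Matrix.exists_vecMul_eq_zero_iff.1 ⟨fun a => f (Pi.single a 1), ?_, ?_⟩)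
  · intro hzero
    refine hf (LinearMap.pi_ext' fun a => LinearMap.ext_ring ?_)
    simpa using congrFun hzero a
  · have hsum : ∀ i j, ∑ a, f (Pi.single a 1) * c a i j = 0 := by
      intro i j
      have h1 : f (L (Pi.single i (Pi.single j 1))) = 0 := hker ⟨_, rfl⟩
      rw [LinearMap.pi_apply_eq_sum_univ f] at h1
      rw [← h1]
      refine Finset.sum_congr rfl fun a _ => ?_
      have h2 : L (Pi.single i (Pi.single j 1)) a = c a i j := blockDifferential_single (c a) i j
      have h3 : (fun j : Fin d => if a = j then (1 : ℝ) else 0) = Pi.single a 1 := by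
        ext l
        simp [Pi.single_apply, eq_comm]
      rw [h2, h3, smul_eq_mul, mul_comm]
    ext b
    simp only [Matrix.vecMul, dotProduct, Matrix.of_apply, Pi.zero_apply, Finset.mul_sum]
    rw [Finset.sum_comm]
    refine Finset.sum_eq_zero fun i _ => ?_
    rw [Finset.sum_comm]
    refine Finset.sum_eq_zero fun j _ => ?_
    rw [Finset.sum_comm]
    refine Finset.sum_eq_zero fun l _ => ?_
    calc ∑ a, f (Pi.single a 1) * (A i j l * c a i j * c b i l)
        = (∑ a, f (Pi.single a 1) * c a i j) * (A i j l * c b i l) := by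
          rw [Finset.sum_mul]
          exact Finset.sum_congr rfl fun a _ => by ring
      _ = 0 := by rw [hsum, zero_mul]

theorem MemDomProd.ae_essDerivAt {n r : ℕ} {k : Fin n → (Fin r → ℝ) → ℝ}
    {ξ : Fin n → Fin r → Fin r → (Fin r → ℝ) → ℝ} (hHG : ∀ i, HG r (k i) (ξ i))
    (hint : ∀ i, Integrable (k i)) (hprob : ∀ i, ∫ y, k i y = 1) {U : (Fin n → Fin r → ℝ) → ℝ}
    {dU : Fin n → Fin r → (Fin n → Fin r → ℝ) → ℝ} (h : MemDomProd n r k ξ U dU)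
    (i : Fin n) (j : Fin r) :
    ∀ᵐ x ∂prodMeasure n r k, EssDerivAt U (Pi.single i (Pi.single j 1)) x (dU i j x) := by
  have hp : ∀ i, IsProbabilityMeasure
      ((volume : Measure (Fin r → ℝ)).withDensity fun y => ENNReal.ofReal (k i y)) := by
    refine fun i => ⟨?_⟩
    rw [withDensity_apply _ .univ, Measure.restrict_univ, ← ofReal_integral_eq_lintegral_ofReal
      (hint i) (Eventually.of_forall (hHG i).k_nonneg), hprob i, ENNReal.ofReal_one]
  refine ae_pi_of_ae_update _ i (measurableSet_essDerivAt h.meas (h.dU_meas i j) _) ?_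
  filter_upwards [h.partialMem i] with x hx
  rw [ae_withDensity_iff (hHG i).k_meas.ennreal_ofReal]
  filter_upwards [hx.ae_essDerivAt (hHG i) (hint i) j] with y hy hne
  have hk : k i y ≠ 0 := fun h0 => hne (by simp [h0])
  intro q
  obtain ⟨m, hm⟩ := hy hk q
  refine ⟨m, ?_⟩
  filter_upwards [hm] with s hs hlt
  have hline : Function.update x i y +
      s • (Pi.single i (Pi.single j 1 : Fin r → ℝ) : Fin n → Fin r → ℝ) =
      Function.update x i (y + s • (Pi.single j 1 : Fin r → ℝ)) := by
    ext l : 1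
    by_cases hl : l = i
    · subst hl; simp
    · simp [hl]
  rw [hline]
  exact hs hlt

end Product

/-- **EID for a finite product.** If each pair `(k_i, ξ^i)` satisfies (HG)
and `∫ k_i dx = 1`, then the product structure on `((ℝ^r)^n, Λ_n)` with carré du champ
`γ̃_n = Σ_i γ_i` satisfies the energy image density property: for every `d ≥ 1` and
`U ∈ (𝐝̃_n)^d`, `U_*[det(γ̃_n[U_a,U_b]) · Λ_n] ≪ λ^d`. -/
theorem energy_image_density_finite_product (n r d : ℕ) (hn : 0 < n) (hd : 0 < d)
    (k : Fin n → (Fin r → ℝ) → ℝ) (ξ : Fin n → Fin r → Fin r → (Fin r → ℝ) → ℝ)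
    (hHG : ∀ i, HG r (k i) (ξ i))
    (hprob : ∀ i, ∫ y, k i y = 1)
    (U : Fin d → (Fin n → Fin r → ℝ) → ℝ)
    (dU : Fin d → Fin n → Fin r → (Fin n → Fin r → ℝ) → ℝ)
    (hmem : ∀ a, MemDomProd n r k ξ (U a) (dU a)) :
    Measure.map (fun x => fun a => U a x)
      ((prodMeasure n r k).withDensity fun x => ENNReal.ofReal
        (Matrix.of fun a b : Fin d =>
            ∑ i, ∑ j, ∑ l, ξ i j l (x i) * dU a i j x * dU b i l x).det)
      ≪ (volume : Measure (Fin d → ℝ)) := by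
  have hint : ∀ i, Integrable (k i) := fun i =>
    not_imp_comm.1 integral_undef (by rw [hprob i]; exact one_ne_zero)
  have hUm : Measurable fun x : Fin n → Fin r → ℝ => fun a => U a x :=
    measurable_pi_iff.2 fun a => (hmem a).meas
  let b : Module.Basis (Σ _ : Fin n, Fin r) ℝ (Fin n → Fin r → ℝ) :=
    Pi.basis fun _ => Pi.basisFun ℝ (Fin r)
  have hb : ∀ p, b p = Pi.single p.1 (Pi.single p.2 1) := fun p => by
    simp [b, Pi.basis_apply, Pi.basisFun_apply]
  let P : Set (Fin n → Fin r → ℝ) :=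
    ⋂ a, ⋂ p : Σ _ : Fin n, Fin r, {x | EssDerivAt (U a) (b p) x (dU a p.1 p.2 x)}
  have hP : MeasurableSet P := .iInter fun a => .iInter fun p =>
    measurableSet_essDerivAt (hmem a).meas ((hmem a).dU_meas _ _) _
  have hPae : ∀ᵐ x ∂prodMeasure n r k, x ∈ P := by
    have : ∀ᵐ x ∂prodMeasure n r k, ∀ a, ∀ p : Σ _ : Fin n, Fin r,
        EssDerivAt (U a) (b p) x (dU a p.1 p.2 x) :=
      ae_all_iff.2 fun a => ae_all_iff.2 fun p => by
        rw [hb]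
        exact (hmem a).ae_essDerivAt hHG hint hprob p.1 p.2
    filter_upwards [this] with x hx
    exact mem_iInter.2 fun a => mem_iInter.2 fun p => hx a p
  have hac : prodMeasure n r k ≪ volume := by
    rw [prodMeasure_eq_withDensity (fun i => (hHG i).k_nonneg) hint]
    exact withDensity_absolutelyContinuous _ _
  refine Measure.AbsolutelyContinuous.mk fun B hB hB0 => ?_
  have hnull := hac.ae_le (ae_notMem_of_essDerivAt (volume : Measure (Fin n → Fin r → ℝ)) b
    (fun a => (hmem a).meas) hP
    (D := fun a x => blockDifferential fun i j => dU a i j x)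
    (fun x hx a p => by
      have := mem_iInter.1 (mem_iInter.1 hx a) p
      rwa [hb, blockDifferential_single, ← hb]) hB hB0)
  rw [Measure.map_apply hUm hB, withDensity_apply _ (hUm hB),
    setLIntegral_congr_fun_ae (g := 0) (hUm hB)]
  · simp
  · filter_upwards [hPae, hnull] with x hxP hx hxB
    have : (Matrix.of fun a b : Fin d =>
        ∑ i, ∑ j, ∑ l, ξ i j l (x i) * dU a i j x * dU b i l x).det = 0 := by
      by_contra hdet
      exact hx hxP (surjective_blockDifferential_of_det_ne_zero (fun i j l => ξ i j l (x i))
        (fun a i j => dU a i j x) hdet) hxB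
    rw [this, ENNReal.ofReal_zero]
    rfl
end
end

section
/- Let F be a set, n ∈ ℕ*, and f_1,…,f_n: F → ℝ functions with pairwise disjoint supports, i.e., for j ≠ k the sets {f_j ≠ 0} and {f_k ≠ 0} are disjoint. Then for all x_1,…,x_n ∈ F: ∏_{j=1}^n ( Σ_{i=1}^n f_j(x_i) ) = Σ_{σ ∈ S_n} ∏_{j=1}^n f_j(x_{σ(j)}), where S_n is the set of permutations of {1,…,n}. -/
open Finset

/-- If `f_1,…,f_n : F → ℝ` have pairwise disjoint supports, then for all
`x_1,…,x_n ∈ F`, `∏_j (Σ_i f_j(x_i)) = Σ_{σ ∈ S_n} ∏_j f_j(x_{σ(j)})`. -/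
theorem prod_sum_eq_sum_perm_of_disjoint_supports {F : Type*} (n : ℕ)
    (f : Fin n → F → ℝ)
    (hdisj : ∀ j k : Fin n, j ≠ k → ∀ y : F, f j y = 0 ∨ f k y = 0)
    (x : Fin n → F) :
    ∏ j : Fin n, (∑ i : Fin n, f j (x i)) =
      ∑ σ : Equiv.Perm (Fin n), ∏ j : Fin n, f j (x (σ j)) := by
  classical
  rw [Fintype.prod_sum]
  symm
  refine Finset.sum_of_injOn (fun σ : Equiv.Perm (Fin n) => (σ : Fin n → Fin n))
    DFunLike.coe_injective.injOn (fun _ _ => Finset.mem_coe.2 (Finset.mem_univ _)) ?_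
    (fun _ _ => rfl)
  intro p _ hp
  have hinj : ¬ Function.Injective p := fun h =>
    hp ⟨Equiv.ofBijective p (Finite.injective_iff_bijective.1 h),
      Finset.mem_coe.2 (Finset.mem_univ _), rfl⟩
  obtain ⟨j, k, hpjk, hjk⟩ := Function.not_injective_iff.1 hinj
  rcases hdisj j k hjk (x (p j)) with h | h
  · exact Finset.prod_eq_zero (Finset.mem_univ j) h
  · exact Finset.prod_eq_zero (Finset.mem_univ k) (hpjk ▸ h)
end

section
/- Let (X, 𝒳, ν) be a measurable space with all singletons measurable and ν a finite diffuse measure with 0 < ν(X) < ∞, and let (Ω₀, P₀, N) be the concrete Poisson space with intensity ν. Then for every measurable f: X → ℝ with f ∈ L¹(ν), the characteristic functional identity holds: E_{P₀}[ e^{i N(f)} ] = exp( ∫_X (e^{i f(x)} − 1) ν(dx) ). -/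
open MeasureTheory Set Finset
open scoped ENNReal

noncomputable section

/-- The Poisson law with parameter `t` on `ℕ` : `P({n}) = e^{−t} tⁿ / n!`. -/
def poissonLaw (t : ℝ) : Measure ℕ :=
  Measure.sum fun n =>
    (ENNReal.ofReal (Real.exp (-t) * t ^ n / n.factorial)) • Measure.dirac n

/-- `N(f)(ω) = Σ_{i=1}^n f(x_i)` for a point `ω = (n, x₁, x₂, …)` of the concrete
Poisson space `Ω₀ = ℕ × X^{ℕ*}` (empty sum = 0). -/
def NN {X : Type*} (f : X → ℝ) (ω : ℕ × (ℕ → X)) : ℝ :=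
  ∑ i ∈ Finset.range ω.1, f (ω.2 i)

/-- The σ-field `𝒜 = σ(N(1_A) : A ∈ 𝒳)` on the concrete Poisson space `Ω₀`. -/
def poissonSigmaAlgebra (X : Type*) [MeasurableSpace X] :
    MeasurableSpace (ℕ × (ℕ → X)) :=
  ⨆ (A : Set X) (_ : MeasurableSet A),
    MeasurableSpace.comap (NN (A.indicator fun _ => (1 : ℝ))) inferInstance

/-- The concrete Poisson probability `P₀` with finite intensity `ν` on `Ω₀ = ℕ × X^{ℕ*}`:
the product of the Poisson law of parameter `ν(X)` with the infinite product `Pseq` of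
countably many copies of the normalized measure `ν/ν(X)`. -/
def poissonP0 {X : Type*} [MeasurableSpace X] (ν : Measure X)
    (Pseq : Measure (ℕ → X)) : Measure (ℕ × (ℕ → X)) :=
  (poissonLaw (ν univ).toReal).prod Pseq

/-- `Pseq` is the infinite product of copies of the normalized measure `ν/ν(X)`,
characterized by its values on measurable cylinders. -/
def IsProductOfNormalized {X : Type*} [MeasurableSpace X] (ν : Measure X)
    (Pseq : Measure (ℕ → X)) : Prop :=
  IsProbabilityMeasure Pseq ∧
  ∀ (s : Finset ℕ) (A : ℕ → Set X), (∀ i, MeasurableSet (A i)) →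
    Pseq {x | ∀ i ∈ s, x i ∈ A i} = ∏ i ∈ s, ((ν univ)⁻¹ * ν (A i))

theorem IsProductOfNormalized.eq_infinitePi {X : Type*} [MeasurableSpace X] {ν : Measure X}
    [IsFiniteMeasure ν] [NeZero ν] {Pseq : Measure (ℕ → X)}
    (h : IsProductOfNormalized ν Pseq) :
    Pseq = Measure.infinitePi fun _ : ℕ => (ν univ)⁻¹ • ν := by
  refine Measure.eq_infinitePi _ fun s t ht => ?_
  simpa [Set.pi] using h.2 s t ht

/-- A Poisson variable of parameter `r` has probability generating function
`z ↦ exp (r (z - 1))`. -/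
theorem integral_pow_poissonMeasure (r : NNReal) (z : ℂ) :
    ∫ n, z ^ n ∂ProbabilityTheory.poissonMeasure r = Complex.exp (r * (z - 1)) := by
  rw [ProbabilityTheory.integral_poissonMeasure]
  have h : ∀ n : ℕ, (Real.exp (-r) * (r : ℝ) ^ n / n.factorial) • z ^ n =
      Complex.exp (-r) * ((r * z) ^ n / n.factorial) := fun n => by
    rw [Complex.real_smul]
    push_cast
    ring
  simp_rw [h, tsum_mul_left]
  rw [← congrFun (NormedSpace.exp_eq_tsum_div (𝔸 := ℂ)) (r * z), ← Complex.exp_eq_exp_ℂ,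
    ← Complex.exp_add]
  ring_nf

theorem integral_prod_range_infinitePi {X : Type*} [MeasurableSpace X] (μ : Measure X)
    [IsProbabilityMeasure μ] {g : X → ℂ} (hg : Measurable g) (n : ℕ) :
    ∫ x, ∏ i ∈ Finset.range n, g (x i) ∂Measure.infinitePi (fun _ : ℕ => μ) =
      (∫ x, g x ∂μ) ^ n := by
  have h := integral_restrict_infinitePi (μ := fun _ : ℕ => μ) (s := Finset.range n)
    (f := fun y => ∏ i, g (y i))
    (Finset.measurable_prod _ fun i _ =>
      hg.comp (measurable_pi_apply i)).aestronglyMeasurable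
  rw [integral_fintype_prod_eq_pow] at h
  rw [Fintype.card_coe, Finset.card_range] at h
  rw [← h]
  congr with x
  exact (Finset.prod_coe_sort (Finset.range n) fun i => g (x i)).symm

theorem measurable_NN {X : Type*} [MeasurableSpace X] {f : X → ℝ} (hf : Measurable f) :
    Measurable (NN f) :=
  measurable_from_prod_countable_right fun n =>
    Finset.measurable_sum (Finset.range n) fun i _ => hf.comp (measurable_pi_apply i)

theorem exp_I_mul_NN {X : Type*} (f : X → ℝ) (ω : ℕ × (ℕ → X)) :
    Complex.exp (Complex.I * NN f ω) =
      ∏ i ∈ Finset.range ω.1, Complex.exp (Complex.I * f (ω.2 i)) := by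
  rw [NN, Complex.ofReal_sum, Finset.mul_sum, Complex.exp_sum]

theorem norm_exp_I_mul_ofReal_le (t : ℝ) : ‖Complex.exp (Complex.I * t)‖ ≤ 1 := by
  rw [mul_comm, Complex.norm_exp_ofReal_mul_I]

/-- On the concrete Poisson space with finite diffuse intensity `ν`,
the characteristic functional identity holds :
`E[e^{iN(f)}] = exp(∫ (e^{if} − 1) dν)` for every `f ∈ L¹(ν)`. -/
theorem poisson_characteristic_functional {X : Type*} [MeasurableSpace X]
    [MeasurableSingletonClass X]
    (ν : Measure X) [IsFiniteMeasure ν] (hpos : 0 < ν univ)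
    (hdiffuse : ∀ x : X, ν {x} = 0)
    (Pseq : Measure (ℕ → X)) (hPseq : IsProductOfNormalized ν Pseq)
    (f : X → ℝ) (hfmeas : Measurable f) (hfint : Integrable f ν) :
    ∫ ω, Complex.exp (Complex.I * (NN f ω : ℂ)) ∂(poissonP0 ν Pseq) =
      Complex.exp (∫ x, (Complex.exp (Complex.I * (f x : ℂ)) - 1) ∂ν) := by
  have : NeZero ν := ⟨fun h => by simp [h] at hpos⟩
  have hexp : Measurable fun x => Complex.exp (Complex.I * (f x : ℂ)) := by fun_prop
  have hexpint : Integrable (fun x => Complex.exp (Complex.I * (f x : ℂ))) ν :=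
    .of_bound hexp.aestronglyMeasurable 1 (ae_of_all _ fun x => norm_exp_I_mul_ofReal_le _)
  set r : NNReal := (ν univ).toNNReal with hr
  have hr0 : (r : ℂ) ≠ 0 := by
    simp [hr, ENNReal.toNNReal_eq_zero_iff, hpos.ne']
  have hP : poissonP0 ν Pseq = (ProbabilityTheory.poissonMeasure r).prod
      (Measure.infinitePi fun _ : ℕ => (ν univ)⁻¹ • ν) := by
    rw [poissonP0, hPseq.eq_infinitePi]
    rfl
  have hNint : Integrable (fun ω => Complex.exp (Complex.I * (NN f ω : ℂ)))
      ((ProbabilityTheory.poissonMeasure r).prod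
        (Measure.infinitePi fun _ : ℕ => (ν univ)⁻¹ • ν)) := by
    have := measurable_NN hfmeas
    exact .of_bound (by fun_prop) 1 (ae_of_all _ fun ω => norm_exp_I_mul_ofReal_le _)
  have hmean : ∫ x, Complex.exp (Complex.I * (f x : ℂ)) ∂((ν univ)⁻¹ • ν) =
      (r : ℂ)⁻¹ * ∫ x, Complex.exp (Complex.I * (f x : ℂ)) ∂ν := by
    rw [integral_smul_measure, Complex.real_smul, ENNReal.toReal_inv]
    push_cast
    rfl
  rw [hP, integral_prod _ hNint]
  simp_rw [exp_I_mul_NN, integral_prod_range_infinitePi _ hexp, integral_pow_poissonMeasure, hmean]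
  rw [integral_sub hexpint (integrable_const 1), mul_sub, mul_inv_cancel_left₀ hr0, integral_const]
  simp [Measure.real, hr, ENNReal.toReal]
end
end
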